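/- (Trigub, 1993) For every r ∈ ℕ there exists a constant c(r) such that for every function f : [−1,1] → ℝ that is (r−1) times differentiable with f^{(r−1)} Lipschitz with constant 1, and every integer n ≥ r−1, there exists a real algebraic polynomial p_n of degree at most n such that for all x ∈ [−1,1]: |f(x) − p_n(x)| ≤ K_r·( √(1−x²)/(n+1) )^r + c(r)·(√(1−x²))^{r−1}/(n+1)^{r+1}. -/

import Mathlib

open Real

/-- The Favard constant `K_r = (4/π) Σ_{ν=0}^∞ (−1)^{ν(r+1)}/(2ν+1)^{r+1}`. -/
noncomputable def favardK (r : ℕ) : ℝ :=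
  (4 / Real.pi) * ∑' ν : ℕ, (-1 : ℝ) ^ (ν * (r + 1)) / ((2 * ν + 1 : ℝ)) ^ (r + 1)

/-- Membership in the class `W^r[−1,1]`: `f` is `(r−1)` times differentiable on `[−1,1]`
and its `(r−1)`-st derivative is Lipschitz there with constant `1`. -/
def MemWSegment (r : ℕ) (f : ℝ → ℝ) : Prop :=
  (∀ i : ℕ, i < r - 1 →
    DifferentiableOn ℝ (iteratedDerivWithin i f (Set.Icc (-1 : ℝ) 1)) (Set.Icc (-1 : ℝ) 1)) ∧
  LipschitzOnWith 1 (iteratedDerivWithin (r - 1) f (Set.Icc (-1 : ℝ) 1)) (Set.Icc (-1 : ℝ) 1)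

namespace Trigub

/-- Real trigonometric polynomials of degree at most `n`. -/
def Tr (n : ℕ) : Submodule ℝ (ℝ → ℝ) :=
  Submodule.span ℝ {g | ∃ k : ℕ, k ≤ n ∧
    (g = (fun t : ℝ => cos (k * t)) ∨ g = (fun t : ℝ => sin (k * t)))}

theorem Tr_cos {n k : ℕ} (h : k ≤ n) : (fun t : ℝ => cos (k * t)) ∈ Tr n :=
  Submodule.subset_span ⟨k, h, Or.inl rfl⟩

theorem Tr_sin {n k : ℕ} (h : k ≤ n) : (fun t : ℝ => sin (k * t)) ∈ Tr n :=
  Submodule.subset_span ⟨k, h, Or.inr rfl⟩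

theorem Tr_mono {m n : ℕ} (h : m ≤ n) {g : ℝ → ℝ} (hg : g ∈ Tr m) : g ∈ Tr n := by
  refine Submodule.span_mono ?_ hg
  rintro g ⟨k, hk, h'⟩
  exact ⟨k, hk.trans h, h'⟩

/-- Induction principle for trigonometric polynomials. -/
theorem Tr_induction {n : ℕ} {P : (ℝ → ℝ) → Prop}
    (hc : ∀ k : ℕ, k ≤ n → P (fun t => cos (k * t)))
    (hs : ∀ k : ℕ, k ≤ n → P (fun t => sin (k * t)))
    (hadd : ∀ f g, f ∈ Tr n → g ∈ Tr n → P f → P g → P (fun t => f t + g t))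
    (hsmul : ∀ (c : ℝ) f, f ∈ Tr n → P f → P (fun t => c * f t))
    {g : ℝ → ℝ} (hg : g ∈ Tr n) : P g := by
  induction hg using Submodule.span_induction with
  | mem x h =>
    obtain ⟨k, hk, h | h⟩ := h
    · rw [h]; exact hc k hk
    · rw [h]; exact hs k hk
  | zero =>
    have := hsmul 0 _ (Tr_cos (Nat.zero_le n)) (hc 0 (Nat.zero_le n))
    convert this using 1
    funext t; simp
  | add x y hx hy h1 h2 => exact hadd x y hx hy h1 h2
  | smul a x hx h => exact hsmul a x hx h

theorem Tr_const (n : ℕ) (c : ℝ) : (fun _ : ℝ => c) ∈ Tr n := by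
  have := (Tr n).smul_mem c (Tr_cos (Nat.zero_le n))
  convert this using 1
  funext t; simp

theorem Tr_add {n : ℕ} {f g : ℝ → ℝ} (hf : f ∈ Tr n) (hg : g ∈ Tr n) :
    (fun t => f t + g t) ∈ Tr n := (Tr n).add_mem hf hg

theorem Tr_sub {n : ℕ} {f g : ℝ → ℝ} (hf : f ∈ Tr n) (hg : g ∈ Tr n) :
    (fun t => f t - g t) ∈ Tr n := (Tr n).sub_mem hf hg

theorem Tr_smul {n : ℕ} {f : ℝ → ℝ} (c : ℝ) (hf : f ∈ Tr n) :
    (fun t => c * f t) ∈ Tr n := (Tr n).smul_mem c hf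

theorem Tr_sum {n : ℕ} {ι : Type*} (S : Finset ι) {f : ι → ℝ → ℝ} (hf : ∀ i ∈ S, f i ∈ Tr n) :
    (fun t => ∑ i ∈ S, f i t) ∈ Tr n := by
  have := (Tr n).sum_mem hf
  convert this using 1
  funext t; simp

theorem cos_diff_mem {n i j : ℕ} (hi : i ≤ n) (hj : j ≤ n) :
    (fun t : ℝ => cos (((i : ℝ) - j) * t)) ∈ Tr n := by
  rcases le_total j i with h | h
  · have := Tr_cos (n := n) (k := i - j) (by omega)
    simpa [Nat.cast_sub h] using this
  · have := Tr_cos (n := n) (k := j - i) (by omega)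
    convert this using 2 with t
    rw [Nat.cast_sub h, ← cos_neg]; congr 1; ring

theorem sin_diff_mem {n i j : ℕ} (hi : i ≤ n) (hj : j ≤ n) :
    (fun t : ℝ => sin (((i : ℝ) - j) * t)) ∈ Tr n := by
  rcases le_total j i with h | h
  · have := Tr_sin (n := n) (k := i - j) (by omega)
    simpa [Nat.cast_sub h] using this
  · have := Tr_smul (-1) (Tr_sin (n := n) (k := j - i) (by omega))
    convert this using 2 with t
    rw [Nat.cast_sub h, neg_one_mul, ← sin_neg]; congr 1; ring

theorem Tr_mul {m n : ℕ} {f g : ℝ → ℝ} (hf : f ∈ Tr m) (hg : g ∈ Tr n) :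
    (fun t => f t * g t) ∈ Tr (m + n) := by
  have hsum : ∀ {i j : ℕ}, i ≤ m → j ≤ n →
      (fun t : ℝ => cos (((i : ℝ) + j) * t)) ∈ Tr (m + n) ∧
      (fun t : ℝ => sin (((i : ℝ) + j) * t)) ∈ Tr (m + n) := by
    intro i j hi hj
    have h1 := Tr_cos (n := m + n) (k := i + j) (by omega)
    have h2 := Tr_sin (n := m + n) (k := i + j) (by omega)
    push_cast at h1 h2
    exact ⟨h1, h2⟩
  refine Tr_induction (P := fun f => (fun t => f t * g t) ∈ Tr (m + n)) ?_ ?_ ?_ ?_ hf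
  · intro i hi
    refine Tr_induction (P := fun g => (fun t : ℝ => cos (i * t) * g t) ∈ Tr (m + n)) ?_ ?_ ?_ ?_ hg
    · intro j hj
      have := Tr_smul (1/2) (Tr_add (hsum hi hj).1 (cos_diff_mem (n := m + n) (i := i) (j := j)
        (by omega) (by omega)))
      convert this using 2 with t
      rw [add_mul, sub_mul, cos_add, cos_sub]; ring
    · intro j hj
      have := Tr_smul (1/2) (Tr_sub (hsum hi hj).2 (sin_diff_mem (n := m + n) (i := i) (j := j)
        (by omega) (by omega)))
      convert this using 2 with t
      rw [add_mul, sub_mul, sin_add, sin_sub]; ring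
    · intro f g _ _ h1 h2
      have := Tr_add h1 h2
      convert this using 2 with t
      ring
    · intro c f _ h1
      have := Tr_smul c h1
      convert this using 2 with t
      ring
  · intro i hi
    refine Tr_induction (P := fun g => (fun t : ℝ => sin (i * t) * g t) ∈ Tr (m + n)) ?_ ?_ ?_ ?_ hg
    · intro j hj
      have := Tr_smul (1/2) (Tr_add (hsum hi hj).2 (sin_diff_mem (n := m + n) (i := i) (j := j)
        (by omega) (by omega)))
      convert this using 2 with t
      rw [add_mul, sub_mul, sin_add, sin_sub]; ring
    · intro j hj
      have := Tr_smul (1/2) (Tr_sub (cos_diff_mem (n := m + n) (i := i) (j := j)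
        (by omega) (by omega)) (hsum hi hj).1)
      convert this using 2 with t
      rw [add_mul, sub_mul, cos_add, cos_sub]; ring
    · intro f g _ _ h1 h2
      have := Tr_add h1 h2
      convert this using 2 with t
      ring
    · intro c f _ h1
      have := Tr_smul c h1
      convert this using 2 with t
      ring
  · intro f g' _ _ h1 h2
    have := Tr_add h1 h2
    convert this using 2 with t
    ring
  · intro c f _ h1
    have := Tr_smul c h1
    convert this using 2 with t
    ring

theorem Tr_pow {m : ℕ} {f : ℝ → ℝ} (hf : f ∈ Tr m) (k : ℕ) :
    (fun t => f t ^ k) ∈ Tr (k * m) := by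
  induction k with
  | zero => simpa using Tr_const 0 1
  | succ k ih =>
    have := Tr_mul ih hf
    simpa [pow_succ, Nat.succ_mul] using this

theorem Tr_cos1 : (fun t : ℝ => cos t) ∈ Tr 1 := by simpa using Tr_cos (le_refl 1)
theorem Tr_sin1 : (fun t : ℝ => sin t) ∈ Tr 1 := by simpa using Tr_sin (le_refl 1)

theorem Tr_poly {n : ℕ} (p : Polynomial ℝ) (hp : p.natDegree ≤ n) :
    (fun t : ℝ => p.eval (cos t)) ∈ Tr n := by
  have : (fun t : ℝ => p.eval (cos t)) =
      fun t => ∑ i ∈ Finset.range (n + 1), p.coeff i * cos t ^ i := by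
    funext t
    exact Polynomial.eval_eq_sum_range' (by omega) _
  rw [this]
  refine Tr_sum _ fun i hi => Tr_smul _ ?_
  have := Tr_pow Tr_cos1 i
  exact Tr_mono (by have := Finset.mem_range.1 hi; omega) this

theorem Tr_even_poly {n : ℕ} {g : ℝ → ℝ} (hg : g ∈ Tr n) :
    ∃ p : Polynomial ℝ, p.natDegree ≤ n ∧ ∀ t, (g t + g (-t)) / 2 = p.eval (cos t) := by
  refine Tr_induction (P := fun g => ∃ p : Polynomial ℝ, p.natDegree ≤ n ∧
    ∀ t, (g t + g (-t)) / 2 = p.eval (cos t)) ?_ ?_ ?_ ?_ hg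
  · intro k hk
    refine ⟨Polynomial.Chebyshev.T ℝ k, ?_, fun t => ?_⟩
    · rw [Polynomial.Chebyshev.natDegree_T]; simpa using hk
    · rw [Polynomial.Chebyshev.T_real_cos]; simp
  · intro k hk
    exact ⟨0, by simp, fun t => by simp⟩
  · rintro f g _ _ ⟨p, hp, h1⟩ ⟨q, hq, h2⟩
    refine ⟨p + q, (Polynomial.natDegree_add_le _ _).trans (max_le hp hq), fun t => ?_⟩
    rw [Polynomial.eval_add, ← h1, ← h2]; ring
  · rintro c f _ ⟨p, hp, h1⟩
    refine ⟨Polynomial.C c * p, (Polynomial.natDegree_C_mul_le _ _).trans hp, fun t => ?_⟩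
    rw [Polynomial.eval_mul, Polynomial.eval_C, ← h1]; ring

theorem Tr_contDiff {n : ℕ} {g : ℝ → ℝ} (hg : g ∈ Tr n) : ContDiff ℝ ⊤ g := by
  refine Tr_induction (P := fun g => ContDiff ℝ ⊤ g) ?_ ?_ ?_ ?_ hg
  · intro k _; fun_prop
  · intro k _; fun_prop
  · intro f g _ _ h1 h2; exact h1.add h2
  · intro c f _ h; exact contDiff_const.mul h

theorem Tr_cont {n : ℕ} {g : ℝ → ℝ} (hg : g ∈ Tr n) : Continuous g := (Tr_contDiff hg).continuous

theorem Tr_diff {n : ℕ} {g : ℝ → ℝ} (hg : g ∈ Tr n) : Differentiable ℝ g :=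
  (Tr_contDiff hg).differentiable (by simp)

theorem Tr_periodic {n : ℕ} {g : ℝ → ℝ} (hg : g ∈ Tr n) : Function.Periodic g (2 * π) := by
  refine Tr_induction (P := fun g => Function.Periodic g (2 * π)) ?_ ?_ ?_ ?_ hg
  · intro k _ t
    simp only [mul_add]
    exact cos_add_nat_mul_two_pi _ k
  · intro k _ t
    simp only [mul_add]
    exact sin_add_nat_mul_two_pi _ k
  · intro f g _ _ h1 h2 t
    simp only [h1 t, h2 t]
  · intro c f _ h t; simp only [h t]

theorem hasDerivAt_cosk (k t : ℝ) : HasDerivAt (fun t => cos (k * t)) (-k * sin (k * t)) t := by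
  have := ((hasDerivAt_id t).const_mul k).cos
  simp only [id] at this
  convert this using 1; ring

theorem hasDerivAt_sink (k t : ℝ) : HasDerivAt (fun t => sin (k * t)) (k * cos (k * t)) t := by
  have := ((hasDerivAt_id t).const_mul k).sin
  simp only [id] at this
  convert this using 1; ring

theorem Tr_deriv {n : ℕ} {g : ℝ → ℝ} (hg : g ∈ Tr n) : deriv g ∈ Tr n := by
  refine Tr_induction (P := fun g => deriv g ∈ Tr n) ?_ ?_ ?_ ?_ hg
  · intro k hk
    have : deriv (fun t : ℝ => cos (k * t)) = fun t => -k * sin (k * t) := by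
      funext t; exact (hasDerivAt_cosk k t).deriv
    rw [this]; exact Tr_smul _ (Tr_sin hk)
  · intro k hk
    have : deriv (fun t : ℝ => sin (k * t)) = fun t => k * cos (k * t) := by
      funext t; exact (hasDerivAt_sink k t).deriv
    rw [this]; exact Tr_smul _ (Tr_cos hk)
  · intro f g hf hg h1 h2
    have : deriv (fun t => f t + g t) = fun t => deriv f t + deriv g t := by
      funext t; exact deriv_fun_add (Tr_diff hf t) (Tr_diff hg t)
    rw [this]; exact Tr_add h1 h2
  · intro c f hf h1
    have : deriv (fun t => c * f t) = fun t => c * deriv f t := by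
      funext t; exact deriv_const_mul _ (Tr_diff hf t)
    rw [this]; exact Tr_smul c h1

theorem Tr_iter {n : ℕ} {g : ℝ → ℝ} (hg : g ∈ Tr n) (i : ℕ) : iteratedDeriv i g ∈ Tr n := by
  induction i with
  | zero => simpa using hg
  | succ i ih => rw [iteratedDeriv_succ]; exact Tr_deriv ih

theorem Tr_antideriv {n : ℕ} {g : ℝ → ℝ} (hg : g ∈ Tr n) :
    ∃ θ ∈ Tr n, ∃ c : ℝ, ∀ t, HasDerivAt θ (g t - c) t := by
  refine Tr_induction (P := fun g => ∃ θ ∈ Tr n, ∃ c : ℝ, ∀ t, HasDerivAt θ (g t - c) t)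
    ?_ ?_ ?_ ?_ hg
  · intro k hk
    rcases Nat.eq_zero_or_pos k with rfl | h0
    · exact ⟨fun _ => 0, Tr_const n 0, 1, fun t => by simpa using hasDerivAt_const t (0 : ℝ)⟩
    · refine ⟨_, Tr_smul ((k : ℝ)⁻¹) (Tr_sin hk), 0, fun t => ?_⟩
      have := (hasDerivAt_sink k t).const_mul ((k : ℝ)⁻¹)
      refine this.congr_deriv ?_
      have : (k : ℝ) ≠ 0 := by positivity
      beta_reduce
      field_simp; ring
  · intro k hk
    rcases Nat.eq_zero_or_pos k with rfl | h0
    · exact ⟨fun _ => 0, Tr_const n 0, 0, fun t => by simpa using hasDerivAt_const t (0 : ℝ)⟩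
    · refine ⟨_, Tr_smul (-(k : ℝ)⁻¹) (Tr_cos hk), 0, fun t => ?_⟩
      have := (hasDerivAt_cosk k t).const_mul (-(k : ℝ)⁻¹)
      refine this.congr_deriv ?_
      have : (k : ℝ) ≠ 0 := by positivity
      beta_reduce
      field_simp; ring
  · rintro f g _ _ ⟨θ, h1, c, h2⟩ ⟨η, h3, d, h4⟩
    refine ⟨_, Tr_add h1 h3, c + d, fun t => ?_⟩
    exact ((h2 t).add (h4 t)).congr_deriv (by ring)
  · rintro a f _ ⟨θ, h1, c, h2⟩
    refine ⟨_, Tr_smul a h1, a * c, fun t => ?_⟩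
    exact ((h2 t).const_mul a).congr_deriv (by ring)

/-- iterated derivatives of sums of trigonometric polynomials -/
theorem iter_sub {m n : ℕ} {f g : ℝ → ℝ} (hf : f ∈ Tr m) (hg : g ∈ Tr n) (i : ℕ) (t : ℝ) :
    iteratedDeriv i (fun t => f t - g t) t = iteratedDeriv i f t - iteratedDeriv i g t :=
  iteratedDeriv_fun_sub ((Tr_contDiff hf).contDiffAt.of_le (by exact le_top))
    ((Tr_contDiff hg).contDiffAt.of_le (by exact le_top))

theorem iter_add {m n : ℕ} {f g : ℝ → ℝ} (hf : f ∈ Tr m) (hg : g ∈ Tr n) (i : ℕ) (t : ℝ) :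
    iteratedDeriv i (fun t => f t + g t) t = iteratedDeriv i f t + iteratedDeriv i g t :=
  iteratedDeriv_fun_add ((Tr_contDiff hf).contDiffAt.of_le (by exact le_top))
    ((Tr_contDiff hg).contDiffAt.of_le (by exact le_top))

theorem Tr_hasDerivAt {n : ℕ} {g : ℝ → ℝ} (hg : g ∈ Tr n) (i : ℕ) (t : ℝ) :
    HasDerivAt (iteratedDeriv i g) (iteratedDeriv (i + 1) g t) t := by
  rw [iteratedDeriv_succ]
  exact (Tr_diff (Tr_iter hg i) t).hasDerivAt

end Trigub

namespace Trigub

theorem integral_cos_nat {m : ℕ} (hm : m ≠ 0) : ∫ u in (-π)..π, cos (m * u) = 0 := by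
  have hm' : (m : ℝ) ≠ 0 := by exact_mod_cast hm
  rw [intervalIntegral.integral_comp_mul_left _ hm', integral_cos, mul_neg, sin_neg, sin_nat_mul_pi]
  simp

/-- Dirichlet kernel. -/
noncomputable def Dk (n : ℕ) (u : ℝ) : ℝ := 1 + ∑ k ∈ Finset.range n, 2 * cos ((k + 1 : ℕ) * u)

theorem Dk_mem (n : ℕ) : Dk n ∈ Tr n := by
  refine Tr_add (Tr_const n 1) (Tr_sum _ fun k hk => Tr_smul 2 (Tr_cos ?_))
  have := Finset.mem_range.1 hk; omega

theorem Dk_even (n : ℕ) (u : ℝ) : Dk n (-u) = Dk n u := by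
  simp [Dk]

theorem Dk_succ (n : ℕ) (u : ℝ) : Dk (n + 1) u = Dk n u + 2 * cos ((n + 1 : ℕ) * u) := by
  simp only [Dk, Finset.sum_range_succ]; ring

theorem Dk_mul_sin (n : ℕ) (u : ℝ) : Dk n u * sin (u / 2) = sin ((n + 1 / 2) * u) := by
  induction n with
  | zero => simp [Dk]; congr 1; ring
  | succ n ih =>
    rw [Dk_succ, add_mul, ih]
    have h1 : ((n : ℝ) + 1 / 2) * u = (n + 1) * u - u / 2 := by ring
    have h2 : (((n + 1 : ℕ) : ℝ) + 1 / 2) * u = (n + 1) * u + u / 2 := by push_cast; ring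
    rw [h1, h2, sin_sub, sin_add]; push_cast; ring

theorem Dk_lower {n : ℕ} (hn : 1 ≤ n) {u : ℝ} (hu : |u| ≤ 1 / n) : (n : ℝ) ≤ Dk n u := by
  have hn' : (0 : ℝ) < n := by exact_mod_cast hn
  have : ∑ k ∈ Finset.range n, (1 : ℝ) ≤ ∑ k ∈ Finset.range n, 2 * cos ((k + 1 : ℕ) * u) := by
    refine Finset.sum_le_sum fun k hk => ?_
    have hk : ((k + 1 : ℕ) : ℝ) ≤ n := by
      have := Finset.mem_range.1 hk
      exact_mod_cast this
    have h1 : |((k + 1 : ℕ) : ℝ) * u| ≤ 1 := by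
      rw [abs_mul, abs_of_nonneg (by positivity)]
      calc ((k + 1 : ℕ) : ℝ) * |u| ≤ n * (1 / n) := by gcongr
        _ = 1 := by field_simp
    have h2 := one_sub_sq_div_two_le_cos (x := ((k + 1 : ℕ) : ℝ) * u)
    have h3 : (((k + 1 : ℕ) : ℝ) * u) ^ 2 ≤ 1 := by
      rw [← sq_abs]; exact pow_le_one₀ (abs_nonneg _) h1
    linarith
  simp only [Finset.sum_const, Finset.card_range, nsmul_eq_mul, mul_one] at this
  unfold Dk; linarith

theorem Dk_cont (n : ℕ) : Continuous (Dk n) := Tr_cont (Dk_mem n)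

theorem integral_Dk_cos (n m : ℕ) (h : n < m) : ∫ u in (-π)..π, Dk n u * cos (m * u) = 0 := by
  induction n with
  | zero => simpa [Dk] using integral_cos_nat (m := m) (by omega)
  | succ n ih =>
    have h1 : ∀ u, Dk (n + 1) u * cos (m * u) =
        Dk n u * cos (m * u) + (cos ((m + (n + 1) : ℕ) * u) + cos ((m - (n + 1) : ℕ) * u)) := by
      intro u
      rw [Dk_succ, Nat.cast_sub h.le, Nat.cast_add m, add_mul, add_mul (m : ℝ), sub_mul, cos_add, cos_sub]; ring
    simp only [h1]
    have := Dk_cont n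
    rw [intervalIntegral.integral_add (Continuous.intervalIntegrable (by fun_prop) _ _)
      (Continuous.intervalIntegrable (by fun_prop) _ _), ih (by omega),
      intervalIntegral.integral_add (Continuous.intervalIntegrable (by fun_prop) _ _)
      (Continuous.intervalIntegrable (by fun_prop) _ _), integral_cos_nat (by omega),
      integral_cos_nat (by omega)]
    simp

theorem integral_Dk_sq (n : ℕ) : ∫ u in (-π)..π, Dk n u ^ 2 = 2 * π * (2 * n + 1) := by
  induction n with
  | zero => simp [Dk]; ring
  | succ n ih =>
    have h1 : ∀ u, Dk (n + 1) u ^ 2 =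
        Dk n u ^ 2 + (4 * (Dk n u * cos ((n + 1 : ℕ) * u)) +
          (2 + 2 * cos ((2 * (n + 1) : ℕ) * u))) := by
      intro u
      have : ((2 * (n + 1) : ℕ) : ℝ) * u = 2 * ((n + 1 : ℕ) * u) := by push_cast; ring
      rw [Dk_succ, this, cos_two_mul]; ring
    simp only [h1]
    have := Dk_cont n
    rw [intervalIntegral.integral_add (Continuous.intervalIntegrable (by fun_prop) _ _)
      (Continuous.intervalIntegrable (by fun_prop) _ _), ih,
      intervalIntegral.integral_add (Continuous.intervalIntegrable (by fun_prop) _ _)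
      (Continuous.intervalIntegrable (by fun_prop) _ _),
      intervalIntegral.integral_const_mul, integral_Dk_cos _ _ (by omega),
      intervalIntegral.integral_add (Continuous.intervalIntegrable (by fun_prop) _ _)
      (Continuous.intervalIntegrable (by fun_prop) _ _),
      intervalIntegral.integral_const_mul, integral_cos_nat (by omega)]
    simp; ring

/-- Jackson type kernels. -/
theorem exists_kernel (p : ℕ) : ∃ C : ℝ, 0 ≤ C ∧ ∀ n : ℕ, 1 ≤ n → ∃ J ∈ Tr (2 * (p + 1) * n),
    (∀ u, 0 ≤ J u) ∧ (∀ u, J (-u) = J u) ∧ (∫ u in (-π)..π, J u = 1) ∧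
    ∫ u in (-π)..π, J u * (1 + n * |u|) ^ (2 * p) ≤ C := by
  refine ⟨2 ^ (2 * p) * (1 + 3 * π ^ (2 * p + 1)), by positivity, fun n hn => ?_⟩
  have hn' : (0 : ℝ) < n := by exact_mod_cast hn
  have hn1 : (1 : ℝ) ≤ n := by exact_mod_cast hn
  have hπ := pi_pos
  have hDc := Dk_cont n
  set I : ℝ := ∫ u in (-π)..π, Dk n u ^ (2 * (p + 1)) with hI
  have hIlow : 2 * (n : ℝ) ^ (2 * p + 1) ≤ I := by
    have h1n : 1 / (n : ℝ) ≤ π := by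
      have : 1 / (n : ℝ) ≤ 1 := by rw [div_le_one hn']; exact hn1
      linarith [pi_gt_three]
    have h1 : ∫ u in (-(1 / (n : ℝ)))..(1 / n), Dk n u ^ (2 * (p + 1)) ≤ I := by
      refine intervalIntegral.integral_mono_interval (by linarith) (by linarith [one_div_pos.2 hn']) h1n ?_
        (Continuous.intervalIntegrable (by fun_prop) _ _)
      refine Filter.Eventually.of_forall fun u => ?_
      simp only [pow_mul]
      positivity
    have h2 : ∫ u in (-(1 / (n : ℝ)))..(1 / n), (n : ℝ) ^ (2 * (p + 1)) ≤
        ∫ u in (-(1 / (n : ℝ)))..(1 / n), Dk n u ^ (2 * (p + 1)) := by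
      refine intervalIntegral.integral_mono_on (by linarith [one_div_pos.2 hn']) (by simp)
        (Continuous.intervalIntegrable (by fun_prop) _ _) fun u hu => ?_
      have : |u| ≤ 1 / n := abs_le.2 ⟨hu.1, hu.2⟩
      have := Dk_lower hn this
      gcongr
    rw [intervalIntegral.integral_const, smul_eq_mul] at h2
    refine le_trans (le_of_eq ?_) (h2.trans h1)
    have : 2 * (p + 1) = (2 * p + 1) + 1 := by ring
    rw [this, pow_succ _ (2 * p + 1)]; field_simp; norm_num
  have hIpos : 0 < I := lt_of_lt_of_le (by positivity) hIlow
  have hJ0 : ∀ u, 0 ≤ I⁻¹ * Dk n u ^ (2 * (p + 1)) := fun u => by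
    have : 0 ≤ Dk n u ^ (2 * (p + 1)) := by rw [pow_mul]; positivity
    positivity
  have hJ1 : ∫ u in (-π)..π, I⁻¹ * Dk n u ^ (2 * (p + 1)) = 1 := by
    rw [intervalIntegral.integral_const_mul, ← hI]; field_simp
  refine ⟨fun u => I⁻¹ * Dk n u ^ (2 * (p + 1)), Tr_smul _ (Tr_pow (Dk_mem n) _), hJ0,
    fun u => by simp only [Dk_even], hJ1, ?_⟩
  have hpt : ∀ u ∈ Set.Icc (-π) π, I⁻¹ * Dk n u ^ (2 * (p + 1)) * (1 + n * |u|) ^ (2 * p) ≤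
      2 ^ (2 * p) * (I⁻¹ * Dk n u ^ (2 * (p + 1))) +
        2 ^ (2 * p) * (n * π) ^ (2 * p) * I⁻¹ * Dk n u ^ 2 := by
    intro u hu
    have hab : |u| ≤ π := abs_le.2 ⟨hu.1, hu.2⟩
    have h1 : |u| ≤ π * |sin (u / 2)| := by
      have := mul_abs_le_abs_sin (x := u / 2) (by rw [abs_div, abs_two]; linarith)
      rw [abs_div, abs_two] at this
      have h3 : 2 / π * (|u| / 2) = |u| / π := by field_simp
      rw [h3, div_le_iff₀ hπ] at this
      linarith
    have h2 : (1 + n * |u|) ^ (2 * p) ≤ 2 ^ (2 * p) * (1 + (n * |u|) ^ (2 * p)) := by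
      have := add_pow_le (zero_le_one) (by positivity : (0 : ℝ) ≤ n * |u|) (2 * p)
      rw [one_pow] at this
      refine this.trans ?_
      gcongr
      · norm_num
      · omega
    have h3 : Dk n u ^ (2 * (p + 1)) * (n * |u|) ^ (2 * p) ≤ (n * π) ^ (2 * p) * Dk n u ^ 2 := by
      have h4 : |Dk n u * sin (u / 2)| ≤ 1 := by rw [Dk_mul_sin]; exact abs_sin_le_one _
      have h5 : (n * |u|) ≤ (n * π) * |sin (u / 2)| := by
        calc n * |u| ≤ n * (π * |sin (u / 2)|) := by gcongr
          _ = _ := by ring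
      have h6 : 0 ≤ Dk n u ^ (2 * (p + 1)) := by rw [pow_mul]; positivity
      calc Dk n u ^ (2 * (p + 1)) * (n * |u|) ^ (2 * p)
          ≤ Dk n u ^ (2 * (p + 1)) * ((n * π) * |sin (u / 2)|) ^ (2 * p) := by gcongr
        _ = (n * π) ^ (2 * p) * (Dk n u ^ 2 * |Dk n u * sin (u / 2)| ^ (2 * p)) := by
            rw [mul_pow, pow_mul (|sin (u / 2)|), pow_mul (|Dk n u * _|), sq_abs, sq_abs,
              mul_pow (Dk n u), mul_pow (Dk n u ^ 2), ← pow_mul (Dk n u)]; ring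
        _ ≤ (n * π) ^ (2 * p) * (Dk n u ^ 2 * 1) := by
            gcongr
            exact pow_le_one₀ (abs_nonneg _) h4
        _ = _ := by ring
    calc I⁻¹ * Dk n u ^ (2 * (p + 1)) * (1 + n * |u|) ^ (2 * p)
        ≤ I⁻¹ * Dk n u ^ (2 * (p + 1)) * (2 ^ (2 * p) * (1 + (n * |u|) ^ (2 * p))) :=
          mul_le_mul_of_nonneg_left h2 (hJ0 u)
      _ = 2 ^ (2 * p) * (I⁻¹ * Dk n u ^ (2 * (p + 1))) +
          2 ^ (2 * p) * I⁻¹ * (Dk n u ^ (2 * (p + 1)) * (n * |u|) ^ (2 * p)) := by ring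
      _ ≤ 2 ^ (2 * p) * (I⁻¹ * Dk n u ^ (2 * (p + 1))) +
          2 ^ (2 * p) * I⁻¹ * ((n * π) ^ (2 * p) * Dk n u ^ 2) := by gcongr
      _ = _ := by ring
  calc ∫ u in (-π)..π, I⁻¹ * Dk n u ^ (2 * (p + 1)) * (1 + n * |u|) ^ (2 * p)
      ≤ ∫ u in (-π)..π, (2 ^ (2 * p) * (I⁻¹ * Dk n u ^ (2 * (p + 1))) +
        2 ^ (2 * p) * (n * π) ^ (2 * p) * I⁻¹ * Dk n u ^ 2) :=
        intervalIntegral.integral_mono_on (by linarith)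
          (Continuous.intervalIntegrable (by fun_prop) _ _)
          (Continuous.intervalIntegrable (by fun_prop) _ _) hpt
    _ = 2 ^ (2 * p) * 1 + 2 ^ (2 * p) * (n * π) ^ (2 * p) * I⁻¹ * (2 * π * (2 * n + 1)) := by
        rw [intervalIntegral.integral_add (Continuous.intervalIntegrable (by fun_prop) _ _)
          (Continuous.intervalIntegrable (by fun_prop) _ _), intervalIntegral.integral_const_mul,
          hJ1, intervalIntegral.integral_const_mul, integral_Dk_sq]
    _ ≤ 2 ^ (2 * p) * 1 + 2 ^ (2 * p) * (n * π) ^ (2 * p) * (2 * (n : ℝ) ^ (2 * p + 1))⁻¹ *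
          (2 * π * (3 * n)) := by
        gcongr
        linarith
    _ = _ := by
        rw [mul_pow, pow_succ (n : ℝ) (2 * p), pow_succ π (2 * p)]; field_simp

/-- Periodic convolution. -/
noncomputable def conv (J g : ℝ → ℝ) (t : ℝ) : ℝ := ∫ u in (-π)..π, J u * g (t - u)

theorem conv_mem {d : ℕ} {J g : ℝ → ℝ} (hJ : J ∈ Tr d) (hg : Continuous g)
    (hp : Function.Periodic g (2 * π)) : conv J g ∈ Tr d := by
  have key : ∀ (J : ℝ → ℝ), Continuous J → Function.Periodic J (2 * π) → ∀ t,
      conv J g t = ∫ v in (-π)..π, J (t - v) * g v := by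
    intro J hJc hJp t
    have h1 : conv J g t = ∫ u in (-π)..π, (fun v => J (t - v) * g v) (t - u) := by
      simp [conv]
    rw [h1, intervalIntegral.integral_comp_sub_left (fun v => J (t - v) * g v) t]
    have hper : Function.Periodic (fun v => J (t - v) * g v) (2 * π) := by
      intro v
      have := hJp (t - (v + 2 * π))
      simp only [hp v]
      rw [← this]; congr 2; ring
    have := hper.intervalIntegral_add_eq (t - π) (-π)
    rw [show t - π + 2 * π = t - -π by ring, show -π + 2 * π = π by ring] at this
    exact this
  refine Tr_induction (P := fun J => conv J g ∈ Tr d) ?_ ?_ ?_ ?_ hJ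
  · intro k hk
    have : conv (fun t => cos (k * t)) g = fun t =>
        (∫ v in (-π)..π, cos (k * v) * g v) * cos (k * t) +
        (∫ v in (-π)..π, sin (k * v) * g v) * sin (k * t) := by
      funext t
      rw [key _ (by fun_prop) (Tr_periodic (Tr_cos hk)), ← intervalIntegral.integral_mul_const,
        ← intervalIntegral.integral_mul_const, ← intervalIntegral.integral_add
        (Continuous.intervalIntegrable (by fun_prop) _ _)
        (Continuous.intervalIntegrable (by fun_prop) _ _)]
      congr 1; funext v
      rw [mul_sub, cos_sub]; ring
    rw [this]
    exact Tr_add (Tr_smul _ (Tr_cos hk)) (Tr_smul _ (Tr_sin hk))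
  · intro k hk
    have : conv (fun t => sin (k * t)) g = fun t =>
        (∫ v in (-π)..π, cos (k * v) * g v) * sin (k * t) -
        (∫ v in (-π)..π, sin (k * v) * g v) * cos (k * t) := by
      funext t
      rw [key _ (by fun_prop) (Tr_periodic (Tr_sin hk)), ← intervalIntegral.integral_mul_const,
        ← intervalIntegral.integral_mul_const, ← intervalIntegral.integral_sub
        (Continuous.intervalIntegrable (by fun_prop) _ _)
        (Continuous.intervalIntegrable (by fun_prop) _ _)]
      congr 1; funext v
      rw [mul_sub, sin_sub]; ring
    rw [this]
    exact Tr_sub (Tr_smul _ (Tr_sin hk)) (Tr_smul _ (Tr_cos hk))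
  · intro f f' hf hf' h1 h2
    have hfc := Tr_cont hf
    have hfc' := Tr_cont hf'
    have : conv (fun t => f t + f' t) g = fun t => conv f g t + conv f' g t := by
      funext t
      unfold conv
      rw [← intervalIntegral.integral_add
        (Continuous.intervalIntegrable (by fun_prop) _ _)
        (Continuous.intervalIntegrable (by fun_prop) _ _)]
      congr 1; funext v; ring
    rw [this]; exact Tr_add h1 h2
  · intro c f hf h
    have : conv (fun t => c * f t) g = fun t => c * conv f g t := by
      funext t
      unfold conv
      rw [← intervalIntegral.integral_const_mul]
      congr 1; funext v; ring
    rw [this]; exact Tr_smul c h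

theorem conv_hasDerivAt {M : ℕ} {J g : ℝ → ℝ} (hJ : Continuous J) (hg : g ∈ Tr M) (t : ℝ) :
    HasDerivAt (conv J g) (conv J (deriv g) t) t := by
  have aux : ∀ (k t : ℝ), conv J (fun t => cos (k * t)) t =
        (∫ v in (-π)..π, J v * cos (k * v)) * cos (k * t) +
        (∫ v in (-π)..π, J v * sin (k * v)) * sin (k * t) := by
    intro k t
    unfold conv
    rw [← intervalIntegral.integral_mul_const,
        ← intervalIntegral.integral_mul_const, ← intervalIntegral.integral_add
        (Continuous.intervalIntegrable (by fun_prop) _ _)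
        (Continuous.intervalIntegrable (by fun_prop) _ _)]
    congr 1; funext v
    beta_reduce
    rw [mul_sub (k : ℝ), cos_sub]; ring
  have aux2 : ∀ (k t : ℝ), conv J (fun t => sin (k * t)) t =
        (∫ v in (-π)..π, J v * cos (k * v)) * sin (k * t) -
        (∫ v in (-π)..π, J v * sin (k * v)) * cos (k * t) := by
    intro k t
    unfold conv
    rw [← intervalIntegral.integral_mul_const,
        ← intervalIntegral.integral_mul_const, ← intervalIntegral.integral_sub
        (Continuous.intervalIntegrable (by fun_prop) _ _)
        (Continuous.intervalIntegrable (by fun_prop) _ _)]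
    congr 1; funext v
    beta_reduce
    rw [mul_sub (k : ℝ), sin_sub]; ring
  have hsm : ∀ (c : ℝ) (f : ℝ → ℝ) t, conv J (fun t => c * f t) t = c * conv J f t := by
    intro c f t
    unfold conv
    rw [← intervalIntegral.integral_const_mul]
    congr 1; funext v; ring
  have had : ∀ (f f' : ℝ → ℝ), Continuous f → Continuous f' → ∀ t,
      conv J (fun t => f t + f' t) t = conv J f t + conv J f' t := by
    intro f f' hfc hfc' t
    unfold conv
    rw [← intervalIntegral.integral_add
        (Continuous.intervalIntegrable (by fun_prop) _ _)
        (Continuous.intervalIntegrable (by fun_prop) _ _)]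
    congr 1; funext v; ring
  refine Tr_induction (P := fun g => ∀ t, HasDerivAt (conv J g) (conv J (deriv g) t) t)
    ?_ ?_ ?_ ?_ hg t
  · intro k hk t
    have : deriv (fun t : ℝ => cos (k * t)) = fun t => -k * sin (k * t) := by
      funext t; exact (hasDerivAt_cosk k t).deriv
    rw [this, hsm, aux2, funext (aux k)]
    refine (((hasDerivAt_cosk k t).const_mul _).add ((hasDerivAt_sink k t).const_mul _)).congr_deriv ?_
    ring
  · intro k hk t
    have : deriv (fun t : ℝ => sin (k * t)) = fun t => k * cos (k * t) := by
      funext t; exact (hasDerivAt_sink k t).deriv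
    rw [this, hsm, aux, funext (aux2 k)]
    refine (((hasDerivAt_sink k t).const_mul _).sub ((hasDerivAt_cosk k t).const_mul _)).congr_deriv ?_
    ring
  · intro f f' hf hf' h1 h2 t
    have : deriv (fun t => f t + f' t) = fun t => deriv f t + deriv f' t := by
      funext t; exact deriv_fun_add (Tr_diff hf t) (Tr_diff hf' t)
    rw [this, had _ _ (Tr_cont (Tr_deriv hf)) (Tr_cont (Tr_deriv hf')),
      funext (had _ _ (Tr_cont hf) (Tr_cont hf'))]
    exact (h1 t).add (h2 t)
  · intro c f hf h1 t
    have : deriv (fun t => c * f t) = fun t => c * deriv f t := by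
      funext t; exact deriv_const_mul _ (Tr_diff hf t)
    rw [this, hsm, funext (hsm c f)]
    exact (h1 t).const_mul c

theorem conv_iter {M : ℕ} {J g : ℝ → ℝ} (hJ : Continuous J) (hg : g ∈ Tr M) (i : ℕ) :
    iteratedDeriv i (conv J g) = conv J (iteratedDeriv i g) := by
  induction i with
  | zero => simp
  | succ i ih =>
    rw [iteratedDeriv_succ, ih, iteratedDeriv_succ]
    funext t
    exact (conv_hasDerivAt hJ (Tr_iter hg i) t).deriv

end Trigub

namespace Trigub

/-- The weight `|sin t| + 1/n`. -/
noncomputable def sw (n : ℕ) (t : ℝ) : ℝ := |sin t| + 1 / n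

theorem sw_pos {n : ℕ} (hn : 1 ≤ n) (t : ℝ) : 0 < sw n t := by
  have hn' : (0 : ℝ) < n := by exact_mod_cast hn
  unfold sw; positivity

theorem sw_nonneg (n : ℕ) (t : ℝ) : 0 ≤ sw n t := by unfold sw; positivity

theorem inv_le_sw (n : ℕ) (t : ℝ) : 1 / (n : ℝ) ≤ sw n t := by
  unfold sw; linarith [abs_nonneg (sin t)]

theorem sin_le_sw (n : ℕ) (t : ℝ) : |sin t| ≤ sw n t := by
  unfold sw; have : 0 ≤ 1 / (n : ℝ) := by positivity
  linarith

theorem sw_le_two {n : ℕ} (hn : 1 ≤ n) (t : ℝ) : sw n t ≤ 2 := by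
  have hn' : (1 : ℝ) ≤ n := by exact_mod_cast hn
  have : 1 / (n : ℝ) ≤ 1 := by rw [div_le_one (by linarith)]; exact hn'
  unfold sw; linarith [abs_sin_le_one t]

theorem one_le_mul_sw {n : ℕ} (hn : 1 ≤ n) (t : ℝ) : 1 ≤ n * sw n t := by
  have hn' : (0 : ℝ) < n := by exact_mod_cast hn
  have := inv_le_sw n t
  rwa [div_le_iff₀' hn'] at this

theorem sw_shift {n : ℕ} (hn : 1 ≤ n) (t t' a : ℝ) (h : |t' - t| ≤ a) :
    sw n t' ≤ sw n t * (1 + n * a) := by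
  have ha : 0 ≤ a := (abs_nonneg _).trans h
  have h1 : |sin t'| ≤ |sin t| + a := by
    have h2 : |sin t' - sin t| ≤ |t' - t| := by
      have := Real.lipschitzWith_sin.dist_le_mul t' t
      simpa [Real.dist_eq] using this
    have := abs_sub_abs_le_abs_sub (sin t') (sin t)
    linarith
  have h3 := one_le_mul_sw hn t
  have h4 : a ≤ a * (n * sw n t) := le_mul_of_one_le_right ha h3
  have : sw n t' ≤ sw n t + a := by unfold sw; linarith
  linarith [this]

theorem conv_bound {J w : ℝ → ℝ} {n j p : ℕ} (hn : 1 ≤ n) {C B : ℝ} (hJc : Continuous J)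
    (hJ0 : ∀ u, 0 ≤ J u) (hj : j ≤ 2 * p)
    (hJm : ∫ u in (-π)..π, J u * (1 + n * |u|) ^ (2 * p) ≤ C) (hB : 0 ≤ B)
    (hw : Continuous w) (hwb : ∀ t, |w t| ≤ B * sw n t ^ j) (t : ℝ) :
    |conv J w t| ≤ C * (B * sw n t ^ j) := by
  have hπ := pi_pos
  have hs := sw_nonneg n t
  have h1 : |conv J w t| ≤ ∫ u in (-π)..π, (J u * (1 + n * |u|) ^ (2 * p)) * (B * sw n t ^ j) := by
    unfold conv
    rw [← Real.norm_eq_abs]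
    refine intervalIntegral.norm_integral_le_of_norm_le (by linarith) ?_
      (Continuous.intervalIntegrable (by fun_prop) _ _)
    refine Filter.Eventually.of_forall fun u _ => ?_
    rw [Real.norm_eq_abs, abs_mul, abs_of_nonneg (hJ0 u), mul_assoc]
    refine mul_le_mul_of_nonneg_left ?_ (hJ0 u)
    have h2 := sw_shift hn t (t - u) |u| (by rw [sub_sub_cancel_left, abs_neg])
    have h3 : (1 : ℝ) ≤ 1 + n * |u| := by
      have : 0 ≤ (n : ℝ) * |u| := by positivity
      linarith
    calc |w (t - u)| ≤ B * sw n (t - u) ^ j := hwb _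
      _ ≤ B * (sw n t * (1 + n * |u|)) ^ j := by
          gcongr; exact sw_nonneg _ _
      _ = (1 + n * |u|) ^ j * (B * sw n t ^ j) := by rw [mul_pow]; ring
      _ ≤ (1 + n * |u|) ^ (2 * p) * (B * sw n t ^ j) := by
          gcongr
  rw [intervalIntegral.integral_mul_const] at h1
  exact h1.trans (by gcongr)

theorem onestep (j : ℕ) : ∃ C : ℝ, 0 ≤ C ∧ ∃ D : ℕ, ∀ n : ℕ, 1 ≤ n → ∀ k d K : ℕ, ∀ M : ℝ, 0 ≤ M →
    ∀ g ∈ Tr K, ∀ τ ∈ Tr d,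
    (∀ i ≤ k, ∀ t, |iteratedDeriv i (fun t => deriv g t - τ t) t| ≤ M * n ^ i * sw n t ^ j) →
    ∃ T ∈ Tr (max d (D * n)), ∀ i ≤ k + 1, ∀ t,
      |iteratedDeriv i (fun t => g t - T t) t| ≤ C * M * n ^ i / n * sw n t ^ j := by
  obtain ⟨C, hC, hker⟩ := exists_kernel (j + 1)
  refine ⟨C + 1, by linarith, 2 * (j + 1 + 1), fun n hn k d K M hM g hg τ hτ hyp => ?_⟩
  have hn' : (0 : ℝ) < n := by exact_mod_cast hn
  have hπ := pi_pos
  obtain ⟨J, hJ, hJ0, hJe, hJ1, hJm⟩ := hker n hn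
  have hJc := Tr_cont hJ
  obtain ⟨θ, hθ, c, hθd⟩ := Tr_antideriv hτ
  set L := max K d with hL
  have hgL : g ∈ Tr L := Tr_mono (le_max_left _ _) hg
  have hθL : θ ∈ Tr L := Tr_mono (le_max_right _ _) hθ
  have hτL : τ ∈ Tr L := Tr_mono (le_max_right _ _) hτ
  set h : ℝ → ℝ := fun t => g t - θ t with hh
  have hhL : h ∈ Tr L := Tr_sub hgL hθL
  set δ : ℝ → ℝ := fun t => deriv g t - τ t with hδ
  have hδL : δ ∈ Tr L := Tr_sub (Tr_deriv hgL) hτL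
  have hder : ∀ t, HasDerivAt h (δ t + c) t := fun t =>
    (((Tr_diff hg t).hasDerivAt).sub (hθd t)).congr_deriv (by simp only [hδ]; ring)
  have hder' : deriv h = fun t => δ t + c := funext fun t => (hder t).deriv
  have hcv : conv J h ∈ Tr (2 * (j + 1 + 1) * n) := conv_mem hJ (Tr_cont hhL) (Tr_periodic hhL)
  refine ⟨fun t => θ t + conv J h t, Tr_add (Tr_mono (le_max_left _ _) hθ)
    (Tr_mono (le_max_right _ _) hcv), fun i hi t => ?_⟩
  have heq : (fun t => g t - (θ t + conv J h t)) = fun t => h t - conv J h t := by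
    funext t; simp only [hh]; ring
  rw [heq, iter_sub hhL hcv, conv_iter hJc hhL]
  have hs := sw_nonneg n t
  rcases Nat.eq_zero_or_pos i with rfl | hi0
  · -- order zero
    simp only [iteratedDeriv_zero, pow_zero, mul_one]
    have hodd : ∫ u in (-π)..π, J u * u = 0 := by
      have := intervalIntegral.integral_comp_neg (a := -π) (b := π) (fun u => J u * u)
      simp only [hJe, neg_neg, mul_neg, intervalIntegral.integral_neg] at this
      linarith
    have hhc := Tr_cont hhL
    have h1 : h t - conv J h t = ∫ u in (-π)..π, J u * (h t - h (t - u) - c * u) := by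
      have : ∀ u, J u * (h t - h (t - u) - c * u) =
          h t * J u - J u * h (t - u) - c * (J u * u) := fun u => by ring
      simp only [this]
      rw [intervalIntegral.integral_sub (Continuous.intervalIntegrable (by fun_prop) _ _)
        (Continuous.intervalIntegrable (by fun_prop) _ _),
        intervalIntegral.integral_sub (Continuous.intervalIntegrable (by fun_prop) _ _)
        (Continuous.intervalIntegrable (by fun_prop) _ _), intervalIntegral.integral_const_mul,
        intervalIntegral.integral_const_mul, hodd, hJ1]
      simp [conv]
    have h2 : |h t - conv J h t| ≤
        ∫ u in (-π)..π, (J u * (1 + n * |u|) ^ (2 * (j + 1))) * (M * sw n t ^ j / n) := by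
      rw [h1, ← Real.norm_eq_abs]
      refine intervalIntegral.norm_integral_le_of_norm_le (by linarith) ?_
        (Continuous.intervalIntegrable (by fun_prop) _ _)
      refine Filter.Eventually.of_forall fun u _ => ?_
      rw [Real.norm_eq_abs, abs_mul, abs_of_nonneg (hJ0 u), mul_assoc]
      refine mul_le_mul_of_nonneg_left ?_ (hJ0 u)
      have h3 : (1 : ℝ) ≤ 1 + n * |u| := by
        have : 0 ≤ (n : ℝ) * |u| := by positivity
        linarith
      have hmv := (convex_uIcc (t - u) t).norm_image_sub_le_of_norm_hasDerivWithin_le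
        (f := fun x => h x - c * x) (f' := δ) (C := M * sw n t ^ j * (1 + n * |u|) ^ j)
        (x := t - u) (y := t)
        (fun x _ => (((hder x).sub ((hasDerivAt_id x).const_mul c)).congr_deriv
          (by ring)).hasDerivWithinAt) (fun x hx => by
            have hx' : |x - t| ≤ |u| := by
              have := Set.abs_sub_right_of_mem_uIcc hx
              rw [sub_sub_cancel] at this
              rwa [abs_sub_comm]
            have := hyp 0 (Nat.zero_le _) x
            simp only [iteratedDeriv_zero, pow_zero, mul_one] at this
            rw [Real.norm_eq_abs]
            calc |δ x| ≤ M * sw n x ^ j := this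
              _ ≤ M * (sw n t * (1 + n * |u|)) ^ j := by
                  gcongr
                  · exact sw_nonneg _ _
                  · exact sw_shift hn _ _ _ hx'
              _ = _ := by rw [mul_pow]; ring) Set.left_mem_uIcc Set.right_mem_uIcc
      rw [Real.norm_eq_abs, Real.norm_eq_abs, sub_sub_cancel] at hmv
      have e1 : h t - h (t - u) - c * u = h t - c * t - (h (t - u) - c * (t - u)) := by ring
      rw [e1]
      refine hmv.trans ?_
      have h5 : |u| ≤ (1 + n * |u|) / n := by
        rw [le_div_iff₀ hn']; linarith
      calc M * sw n t ^ j * (1 + n * |u|) ^ j * |u|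
          ≤ M * sw n t ^ j * (1 + n * |u|) ^ j * ((1 + n * |u|) / n) := by gcongr
        _ = (1 + n * |u|) ^ (j + 1) * (M * sw n t ^ j / n) := by rw [pow_succ]; ring
        _ ≤ (1 + n * |u|) ^ (2 * (j + 1)) * (M * sw n t ^ j / n) := by
            gcongr
            omega
    rw [intervalIntegral.integral_mul_const] at h2
    calc _ ≤ _ := h2
      _ ≤ C * (M * sw n t ^ j / n) := by gcongr
      _ ≤ (C + 1) * (M * sw n t ^ j / n) := by gcongr; linarith
      _ = _ := by ring
  · -- higher orders
    obtain ⟨i, rfl⟩ : ∃ i', i = i' + 1 := ⟨i - 1, by omega⟩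
    have hid : ∃ c' : ℝ, iteratedDeriv (i + 1) h = fun t => iteratedDeriv i δ t + c' := by
      rw [iteratedDeriv_succ', hder']
      refine ⟨if i = 0 then c else 0, funext fun t => ?_⟩
      rw [iter_add hδL (Tr_const 0 c)]
      simp [iteratedDeriv_const]
    obtain ⟨c', hc'⟩ := hid
    have hwc := Tr_cont (Tr_iter hδL i)
    have e1 : conv J (iteratedDeriv (i + 1) h) t = conv J (iteratedDeriv i δ) t + c' := by
      rw [hc']
      unfold conv
      simp only [mul_add]
      rw [intervalIntegral.integral_add (Continuous.intervalIntegrable (by fun_prop) _ _)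
        (Continuous.intervalIntegrable (by fun_prop) _ _), intervalIntegral.integral_mul_const, hJ1,
        one_mul]
    have hy := hyp i (by omega)
    have h2 := conv_bound (J := J) (w := iteratedDeriv i δ) (n := n) (j := j) (p := j + 1) hn
      (B := M * n ^ i) hJc hJ0 (by omega) hJm (by positivity) hwc hy t
    have e2 : iteratedDeriv (i + 1) h t - conv J (iteratedDeriv (i + 1) h) t =
        iteratedDeriv i δ t - conv J (iteratedDeriv i δ) t := by
      rw [e1, hc']; ring
    rw [e2]
    have h3 := abs_sub (iteratedDeriv i δ t) (conv J (iteratedDeriv i δ) t)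
    have h4 := hy t
    have e3 : (C + 1) * M * (n : ℝ) ^ (i + 1) / n * sw n t ^ j =
        C * (M * n ^ i * sw n t ^ j) + M * n ^ i * sw n t ^ j := by
      rw [pow_succ]; field_simp
    rw [e3]; linarith

/-- Multi-step lemma: approximation of the `r`-th derivative gives simultaneous approximation. -/
theorem multistep (j r : ℕ) : ∃ C : ℝ, 0 ≤ C ∧ ∃ D : ℕ, ∀ n : ℕ, 1 ≤ n → ∀ d K : ℕ, ∀ M : ℝ, 0 ≤ M →
    ∀ g ∈ Tr K, ∀ τ ∈ Tr d, (∀ t, |iteratedDeriv r g t - τ t| ≤ M * sw n t ^ j) →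
    ∃ T ∈ Tr (max d (D * n)), ∀ i ≤ r, ∀ t,
      |iteratedDeriv i (fun t => g t - T t) t| ≤ C * M * n ^ i / n ^ r * sw n t ^ j := by
  obtain ⟨C1, hC1, D, h1⟩ := onestep j
  induction r with
  | zero =>
    refine ⟨1, zero_le_one, 0, fun n hn d K M hM g hg τ hτ hyp => ?_⟩
    refine ⟨τ, by simpa using hτ, fun i hi t => ?_⟩
    obtain rfl : i = 0 := by omega
    simpa using hyp t
  | succ r ih =>
    obtain ⟨C, hC, D', h2⟩ := ih
    refine ⟨C1 * C, by positivity, max D D', fun n hn d K M hM g hg τ hτ hyp => ?_⟩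
    have hn' : (0 : ℝ) < n := by exact_mod_cast hn
    obtain ⟨T', hT', hb'⟩ := h2 n hn d K M hM (deriv g) (Tr_deriv hg) τ hτ (fun t => by
      rw [← iteratedDeriv_succ']; exact hyp t)
    obtain ⟨T, hT, hb⟩ := h1 n hn r _ K (C * M / n ^ r) (by positivity) g hg T' hT' (fun i hi t => by
      refine (hb' i hi t).trans (le_of_eq ?_); ring)
    refine ⟨T, Tr_mono ?_ hT, fun i hi t => (hb i hi t).trans (le_of_eq ?_)⟩
    · have a1 : D' * n ≤ max D D' * n := Nat.mul_le_mul_right _ (le_max_right _ _)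
      have a2 : D * n ≤ max D D' * n := Nat.mul_le_mul_right _ (le_max_left _ _)
      omega
    · rw [pow_succ (n : ℝ) r]; field_simp

end Trigub

namespace Trigub

/-- `a` is a trigonometric polynomial divisible by `sin ^ l`. -/
def Z (l : ℕ) (a : ℝ → ℝ) : Prop := ∃ d : ℕ, ∃ b ∈ Tr d, ∀ t, a t = sin t ^ l * b t

theorem Z_mem {l : ℕ} {a : ℝ → ℝ} (h : Z l a) : ∃ d, a ∈ Tr d := by
  obtain ⟨d, b, hb, hab⟩ := h
  refine ⟨l * 1 + d, ?_⟩
  rw [show a = fun t => sin t ^ l * b t from funext hab]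
  exact Tr_mul (Tr_pow Tr_sin1 l) hb

theorem Tr_bounded {d : ℕ} {g : ℝ → ℝ} (hg : g ∈ Tr d) : ∃ C : ℝ, 0 ≤ C ∧ ∀ t, |g t| ≤ C := by
  refine Tr_induction (P := fun g => ∃ C : ℝ, 0 ≤ C ∧ ∀ t, |g t| ≤ C) ?_ ?_ ?_ ?_ hg
  · exact fun k _ => ⟨1, zero_le_one, fun t => abs_cos_le_one _⟩
  · exact fun k _ => ⟨1, zero_le_one, fun t => abs_sin_le_one _⟩
  · rintro f g _ _ ⟨C, hC, h⟩ ⟨C', hC', h'⟩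
    exact ⟨C + C', by positivity, fun t => (abs_add_le _ _).trans (add_le_add (h t) (h' t))⟩
  · rintro c f _ ⟨C, hC, h⟩
    exact ⟨|c| * C, by positivity, fun t => by rw [abs_mul]; gcongr; exact h t⟩

theorem Z_bound {l : ℕ} {a : ℝ → ℝ} (h : Z l a) : ∃ C : ℝ, 0 ≤ C ∧ ∀ t, |a t| ≤ C * |sin t| ^ l := by
  obtain ⟨d, b, hb, hab⟩ := h
  obtain ⟨C, hC, h⟩ := Tr_bounded hb
  refine ⟨C, hC, fun t => ?_⟩
  rw [hab, abs_mul, abs_pow, mul_comm]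
  gcongr; exact h t

theorem Z_zero (l : ℕ) : Z l (fun _ => 0) := ⟨0, fun _ => 0, Tr_const 0 0, fun t => by simp⟩

theorem Z_sub {l : ℕ} {a a' : ℝ → ℝ} (h : Z l a) (h' : Z l a') : Z l (fun t => a t - a' t) := by
  obtain ⟨d, b, hb, hab⟩ := h
  obtain ⟨d', b', hb', hab'⟩ := h'
  exact ⟨max d d', fun t => b t - b' t, Tr_sub (Tr_mono (le_max_left _ _) hb)
    (Tr_mono (le_max_right _ _) hb'), fun t => by beta_reduce; rw [hab, hab']; ring⟩

theorem Z_le {l l' : ℕ} (hl : l' ≤ l) {a : ℝ → ℝ} (h : Z l a) : Z l' a := by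
  obtain ⟨d, b, hb, hab⟩ := h
  refine ⟨(l - l') * 1 + d, fun t => sin t ^ (l - l') * b t, Tr_mul (Tr_pow Tr_sin1 _) hb, fun t => ?_⟩
  rw [hab, ← mul_assoc, ← pow_add]
  congr 2; omega

theorem Z_sin {l : ℕ} {a : ℝ → ℝ} (h : Z l a) : Z (l + 1) (fun t => sin t * a t) := by
  obtain ⟨d, b, hb, hab⟩ := h
  exact ⟨d, b, hb, fun t => by beta_reduce; rw [hab]; ring⟩

theorem Z_deriv {l : ℕ} {a : ℝ → ℝ} (h : Z l a) : Z (l - 1) (deriv a) := by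
  obtain ⟨d, b, hb, hab⟩ := h
  rw [show a = fun t => sin t ^ l * b t from funext hab]
  have hd : ∀ t, HasDerivAt (fun t => sin t ^ l * b t)
      (l * sin t ^ (l - 1) * cos t * b t + sin t ^ l * deriv b t) t := fun t =>
    ((hasDerivAt_sin t).pow l).mul (Tr_diff hb t).hasDerivAt
  refine ⟨1 + d, fun t => cos t * (l * b t) + sin t ^ (l - (l - 1)) * deriv b t, ?_, fun t => ?_⟩
  · refine Tr_add (Tr_mul Tr_cos1 (Tr_smul _ hb)) ?_
    refine Tr_mono ?_ (Tr_mul (Tr_pow Tr_sin1 (l - (l - 1))) (Tr_deriv hb))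
    omega
  · rw [(hd t).deriv, mul_add, ← mul_assoc (sin t ^ (l - 1)) (sin t ^ (l - (l - 1))), ← pow_add]
    rw [show l - 1 + (l - (l - 1)) = l by omega]
    ring

/-- The coefficients in the formula for higher derivatives of `f ∘ cos`. -/
noncomputable def fa : ℕ → ℕ → ℝ → ℝ
  | 0, 0 => fun _ => 1
  | 0, _ + 1 => fun _ => 0
  | r + 1, 0 => deriv (fa r 0)
  | r + 1, k + 1 => fun t => deriv (fa r (k + 1)) t - sin t * fa r k t

theorem fa_Z (r k : ℕ) : Z (2 * k - r) (fa r k) := by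
  induction r generalizing k with
  | zero =>
    cases k with
    | zero => exact ⟨0, fun _ => 1, Tr_const 0 1, fun t => by simp [fa]⟩
    | succ k => exact Z_zero _
  | succ r ih =>
    cases k with
    | zero => exact Z_le (by omega) (Z_deriv (ih 0))
    | succ k =>
      exact Z_sub (Z_le (by omega) (Z_deriv (ih (k + 1)))) (Z_le (by omega) (Z_sin (ih k)))

theorem fa_gt (r k : ℕ) (h : r < k) : fa r k = fun _ => 0 := by
  induction r generalizing k with
  | zero =>
    cases k with
    | zero => omega
    | succ k => rfl
  | succ r ih =>
    cases k with
    | zero => omega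
    | succ k =>
      funext t
      simp [fa, ih (k + 1) (by omega), ih k (by omega)]

theorem fa_self (r : ℕ) : fa r r = fun t => (-sin t) ^ r := by
  induction r with
  | zero => funext t; simp [fa]
  | succ r ih =>
    funext t
    simp only [fa, ih, fa_gt r (r + 1) (by omega)]
    simp; ring

theorem fa_zero (r : ℕ) : fa (r + 1) 0 = fun _ => 0 := by
  induction r with
  | zero => funext t; simp [fa]
  | succ r ih => rw [fa, ih]; simp

theorem fa_formula (r : ℕ) (f : Polynomial ℝ) (t : ℝ) :
    iteratedDeriv r (fun t => f.eval (cos t)) t =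
      ∑ k ∈ Finset.range (r + 1), (Polynomial.derivative^[k] f).eval (cos t) * fa r k t := by
  induction r generalizing t with
  | zero => simp [fa]
  | succ r ih =>
    rw [iteratedDeriv_succ, show iteratedDeriv r (fun t => f.eval (cos t)) = _ from funext ih]
    have h1 : ∀ k, HasDerivAt (fun t => (Polynomial.derivative^[k] f).eval (cos t))
        ((Polynomial.derivative^[k + 1] f).eval (cos t) * (-sin t)) t := fun k => by
      rw [Function.iterate_succ_apply']
      exact (Polynomial.hasDerivAt _ _).comp t (hasDerivAt_cos t)
    have h2 : ∀ k, HasDerivAt (fa r k) (deriv (fa r k) t) t := fun k => by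
      obtain ⟨d, hd⟩ := Z_mem (fa_Z r k)
      exact (Tr_diff hd t).hasDerivAt
    have h3 := HasDerivAt.fun_sum (u := Finset.range (r + 1)) (fun k _ => (h1 k).mul (h2 k))
    rw [show deriv (fun t => ∑ k ∈ Finset.range (r + 1),
      (Polynomial.derivative^[k] f).eval (cos t) * fa r k t) t = _ from h3.deriv]
    rw [Finset.sum_add_distrib, Finset.sum_range_succ' _ (r + 1)]
    simp only [fa, mul_sub, Finset.sum_sub_distrib]
    have h4 : ∑ k ∈ Finset.range (r + 1),
        (Polynomial.derivative^[k] f).eval (cos t) * deriv (fa r k) t =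
        ∑ k ∈ Finset.range (r + 1),
        (Polynomial.derivative^[k + 1] f).eval (cos t) * deriv (fa r (k + 1)) t +
        (Polynomial.derivative^[0] f).eval (cos t) * deriv (fa r 0) t := by
      rw [← Finset.sum_range_succ' (fun k =>
        (Polynomial.derivative^[k] f).eval (cos t) * deriv (fa r k) t), Finset.sum_range_succ _ (r + 1)]
      simp [fa_gt r (r + 1) (by omega)]
    rw [h4]
    have h5 : ∀ k, (Polynomial.derivative^[k + 1] f).eval (cos t) * -sin t * fa r k t =
        -((Polynomial.derivative^[k + 1] f).eval (cos t) * (sin t * fa r k t)) := fun k => by ring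
    simp only [h5, Finset.sum_neg_distrib]
    ring

/-- Approximability by trigonometric polynomials of degree `D * n` with weight `W`. -/
def App (n D : ℕ) (C : ℝ) (W g : ℝ → ℝ) : Prop := ∃ T ∈ Tr (D * n), ∀ t, |g t - T t| ≤ C * W t

theorem App_sum {n : ℕ} {W : ℝ → ℝ} {ι : Type*} (S : Finset ι) {D : ι → ℕ} {C : ι → ℝ}
    {g : ι → ℝ → ℝ} (h : ∀ i ∈ S, App n (D i) (C i) W (g i)) :
    App n (∑ i ∈ S, D i) (∑ i ∈ S, C i) W (fun t => ∑ i ∈ S, g i t) := by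
  choose! T hT hb using h
  refine ⟨fun t => ∑ i ∈ S, T i t, Tr_sum S fun i hi => Tr_mono ?_ (hT i hi), fun t => ?_⟩
  · exact Nat.mul_le_mul_right _ (Finset.single_le_sum (f := D) (fun _ _ => Nat.zero_le _) hi)
  · rw [← Finset.sum_sub_distrib, Finset.sum_mul]
    exact (Finset.abs_sum_le_sum_abs _ _).trans (Finset.sum_le_sum fun i hi => hb i hi t)

theorem App_add {n D D' : ℕ} {C C' : ℝ} {W g g' : ℝ → ℝ} (h : App n D C W g)
    (h' : App n D' C' W g') : App n (D + D') (C + C') W (fun t => g t + g' t) := by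
  obtain ⟨T, hT, hb⟩ := h
  obtain ⟨T', hT', hb'⟩ := h'
  refine ⟨fun t => T t + T' t, Tr_add (Tr_mono (Nat.mul_le_mul_right _ (by omega)) hT)
    (Tr_mono (Nat.mul_le_mul_right _ (by omega)) hT'), fun t => ?_⟩
  have := abs_add_le (g t - T t) (g' t - T' t)
  rw [show g t + g' t - (T t + T' t) = g t - T t + (g' t - T' t) by ring, add_mul]
  linarith [hb t, hb' t]

theorem App_mul {n D d : ℕ} {C A : ℝ} {W W' g a : ℝ → ℝ} (hn : 1 ≤ n) (hC : 0 ≤ C)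
    (h : App n D C W g) (ha : a ∈ Tr d) (hA : ∀ t, |a t| * W t ≤ A * W' t) :
    App n (D + d) (C * A) W' (fun t => g t * a t) := by
  obtain ⟨T, hT, hb⟩ := h
  refine ⟨fun t => T t * a t, Tr_mono ?_ (Tr_mul hT ha), fun t => ?_⟩
  · nlinarith
  · rw [← sub_mul, abs_mul]
    calc |g t - T t| * |a t| ≤ C * W t * |a t| := by gcongr; exact hb t
      _ = C * (|a t| * W t) := by ring
      _ ≤ C * (A * W' t) := mul_le_mul_of_nonneg_left (hA t) hC
      _ = _ := by ring

theorem pow_le_two {s : ℝ} (h0 : 0 ≤ s) (h2 : s ≤ 2) {a b : ℕ} (h : a ≤ b) :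
    s ^ b ≤ 2 ^ b * s ^ a := by
  obtain ⟨c, rfl⟩ := Nat.exists_eq_add_of_le h
  rw [pow_add s, mul_comm]
  gcongr
  calc s ^ c ≤ 2 ^ c := by gcongr
    _ ≤ 2 ^ (a + c) := by gcongr <;> norm_num

/-- Approximation of one term `f^{(k)}(cos t) * fa r k t`. -/
theorem sw_term (r k v : ℕ) (hk : k ≤ r) (hv : v ≤ r - k) :
    ∃ A : ℝ, 0 ≤ A ∧ ∀ n : ℕ, 1 ≤ n → ∀ t,
      |fa r k t| * (sw n t ^ (r - k) / n ^ (r - k)) ≤ A * (sw n t ^ (r - v) / n ^ v) := by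
  obtain ⟨C, hC, h⟩ := Z_bound (fa_Z r k)
  refine ⟨C * 2 ^ (2 * k - r + (r - k) + (r - k - v)), by positivity, fun n hn t => ?_⟩
  have hn' : (0 : ℝ) < n := by exact_mod_cast hn
  have hs := sw_nonneg n t
  have h1 : (1 : ℝ) / n ^ (r - k) ≤ sw n t ^ (r - k - v) / n ^ v := by
    have : (1 : ℝ) / n ^ (r - k) = (1 / n) ^ (r - k - v) / n ^ v := by
      rw [div_pow, one_pow, div_div, ← pow_add]; congr 2; omega
    rw [this]
    gcongr
    exact inv_le_sw n t
  calc |fa r k t| * (sw n t ^ (r - k) / n ^ (r - k))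
      ≤ (C * sw n t ^ (2 * k - r)) * (sw n t ^ (r - k) / n ^ (r - k)) := by
        gcongr
        refine (h t).trans ?_
        gcongr
        exact sin_le_sw n t
    _ = C * sw n t ^ (2 * k - r) * sw n t ^ (r - k) * (1 / n ^ (r - k)) := by ring
    _ ≤ C * sw n t ^ (2 * k - r) * sw n t ^ (r - k) * (sw n t ^ (r - k - v) / n ^ v) := by gcongr
    _ = C * sw n t ^ (2 * k - r + (r - k) + (r - k - v)) / n ^ v := by rw [pow_add, pow_add]; ring
    _ ≤ C * (2 ^ (2 * k - r + (r - k) + (r - k - v)) * sw n t ^ (r - v)) / n ^ v := by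
        gcongr
        exact pow_le_two hs (sw_le_two hn t) (by omega)
    _ = _ := by ring

theorem S_lemma (r : ℕ) : ∃ C : ℝ, 0 ≤ C ∧ ∃ D : ℕ, ∀ f : Polynomial ℝ,
    (∀ x ∈ Set.Icc (-1 : ℝ) 1, |(Polynomial.derivative^[r] f).eval x| ≤ 1) → ∀ n : ℕ, 1 ≤ n →
      App n D C (fun t => sw n t ^ r / n ^ r) (fun t => f.eval (cos t)) := by
  induction r using Nat.strong_induction_on with
  | _ r ih =>
  rcases Nat.eq_zero_or_pos r with rfl | hr
  · refine ⟨1, zero_le_one, 0, fun f hf n hn => ⟨fun _ => 0, Tr_const _ 0, fun t => ?_⟩⟩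
    simpa using hf (cos t) ⟨neg_one_le_cos t, cos_le_one t⟩
  choose! C0 hC0 D0 h0 using ih
  have hA : ∀ k : ℕ, ∃ A : ℝ, 0 ≤ A ∧ (k ≤ r → ∀ n : ℕ, 1 ≤ n → ∀ t,
      |fa r k t| * (sw n t ^ (r - k) / n ^ (r - k)) ≤ A * (sw n t ^ (r - 0) / n ^ 0)) := fun k => by
    by_cases hk : k ≤ r
    · obtain ⟨A, hA, h⟩ := sw_term r k 0 hk (Nat.zero_le _)
      exact ⟨A, hA, fun _ => h⟩
    · exact ⟨0, le_rfl, fun h => absurd h hk⟩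
  choose A hA0 hA using hA
  choose d hd using fun k => Z_mem (fa_Z r k)
  obtain ⟨C1, hC1, D1, h1⟩ := multistep r r
  set M := ∑ k ∈ Finset.range r, C0 (r - (k + 1)) * A (k + 1) with hM
  have hM0 : 0 ≤ M := Finset.sum_nonneg fun k hk =>
    mul_nonneg (hC0 _ (by have := Finset.mem_range.1 hk; omega)) (hA0 _)
  set DD := ∑ k ∈ Finset.range r, (D0 (r - (k + 1)) + d (k + 1)) with hDD
  refine ⟨C1 * M, by positivity, max DD D1, fun f hf n hn => ?_⟩
  have hn' : (0 : ℝ) < n := by exact_mod_cast hn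
  have h2 : App n DD M (fun t => sw n t ^ r)
      (fun t => ∑ k ∈ Finset.range r,
        (Polynomial.derivative^[k + 1] f).eval (cos t) * fa r (k + 1) t) := by
    refine App_sum _ fun k hk => ?_
    have hk' := Finset.mem_range.1 hk
    refine App_mul hn (hC0 _ (by omega)) (h0 (r - (k + 1)) (by omega) _ ?_ n hn) (hd (k + 1)) ?_
    · intro x hx
      rw [← Function.iterate_add_apply, show r - (k + 1) + (k + 1) = r by omega]
      exact hf x hx
    · intro t
      simpa using hA (k + 1) (by omega) n hn t
  obtain ⟨τ, hτ, hb⟩ := h2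
  have h3 : ∀ t, iteratedDeriv r (fun t => f.eval (cos t)) t = ∑ k ∈ Finset.range r,
        (Polynomial.derivative^[k + 1] f).eval (cos t) * fa r (k + 1) t := fun t => by
    rw [fa_formula, Finset.sum_range_succ']
    obtain ⟨r', rfl⟩ : ∃ r', r = r' + 1 := ⟨r - 1, by omega⟩
    rw [fa_zero]; simp
  obtain ⟨T, hT, hb'⟩ := h1 n hn _ f.natDegree M hM0 _ (Tr_poly f le_rfl) τ hτ (fun t => by
    rw [h3]; exact hb t)
  refine ⟨T, Tr_mono ?_ hT, fun t => ?_⟩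
  · rw [max_mul_of_nonneg _ _ (Nat.zero_le _)]
  · have := hb' 0 (Nat.zero_le _) t
    simp only [iteratedDeriv_zero, pow_zero, mul_one] at this
    refine this.trans (le_of_eq ?_); ring

end Trigub

namespace Trigub

theorem Z_iter {l : ℕ} {a : ℝ → ℝ} (h : Z l a) (i : ℕ) : Z (l - i) (iteratedDeriv i a) := by
  induction i with
  | zero => simpa using h
  | succ i ih => rw [iteratedDeriv_succ]; exact Z_le (by omega) (Z_deriv ih)

theorem sin_pow_iter (l d : ℕ) {b : ℝ → ℝ} (hb : b ∈ Tr d) {t0 : ℝ} (h0 : sin t0 = 0) :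
    iteratedDeriv l (fun t => sin t ^ l * b t) t0 = l.factorial * cos t0 ^ l * b t0 := by
  induction l generalizing b d with
  | zero => simp
  | succ l ih =>
    rw [iteratedDeriv_succ']
    have hd : deriv (fun t => sin t ^ (l + 1) * b t) =
        fun t => sin t ^ l * (cos t * ((l + 1) * b t) + sin t * deriv b t) := by
      funext t
      have h1 := (((hasDerivAt_sin t).pow (l + 1)).mul (Tr_diff hb t).hasDerivAt).deriv
      refine (Eq.trans ?_ h1).trans ?_
      · rfl
      · simp; ring
    rw [hd, ih (1 + d) (Tr_add (Tr_mul Tr_cos1 (Tr_smul _ hb)) (Tr_mul Tr_sin1 (Tr_deriv hb))), h0,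
      Nat.factorial_succ]
    push_cast; ring

theorem sw_at_zero {n : ℕ} {t0 : ℝ} (h0 : sin t0 = 0) : sw n t0 = 1 / n := by simp [sw, h0]

theorem corr_aux (j l : ℕ) (hl : l ≤ j) : ∃ C : ℝ, 0 ≤ C ∧ ∀ n : ℕ, 1 ≤ n → ∀ K : ℕ, ∀ M : ℝ, 0 ≤ M →
    ∀ e ∈ Tr K, (∀ i ≤ j, ∀ t, |iteratedDeriv i e t| ≤ M * n ^ i * sw n t ^ j) →
    ∃ q ∈ Tr l, (∀ i ≤ j, ∀ t, |iteratedDeriv i (fun t => e t - q t) t| ≤ C * M * n ^ i * sw n t ^ j) ∧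
      ∀ i < l, iteratedDeriv i (fun t => e t - q t) 0 = 0 ∧
        iteratedDeriv i (fun t => e t - q t) π = 0 := by
  induction l with
  | zero =>
    refine ⟨1, zero_le_one, fun n hn K M hM e he h => ⟨fun _ => 0, Tr_const _ 0, ?_, ?_⟩⟩
    · intro i hi t; simpa using h i hi t
    · intro i hi; omega
  | succ l ih =>
    obtain ⟨C, hC, hih⟩ := ih (by omega)
    have hZu : Z l (fun t => sin t ^ l * 1) := ⟨0, fun _ => 1, Tr_const 0 1, fun t => rfl⟩
    have hZv : Z l (fun t => sin t ^ l * cos t) := ⟨1, fun t => cos t, Tr_cos1, fun t => rfl⟩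
    choose Au hAu0 hAu using fun i => Z_bound (Z_iter hZu i)
    choose Av hAv0 hAv using fun i => Z_bound (Z_iter hZv i)
    set A := ∑ i ∈ Finset.range (j + 1), (Au i + Av i) with hA
    have hA0 : 0 ≤ A := Finset.sum_nonneg fun i _ => add_nonneg (hAu0 i) (hAv0 i)
    have hAi : ∀ i ≤ j, Au i + Av i ≤ A := fun i hi =>
      Finset.single_le_sum (f := fun i => Au i + Av i) (fun i _ => add_nonneg (hAu0 i) (hAv0 i))
        (Finset.mem_range.2 (by omega))
    refine ⟨C + C * A, by positivity, fun n hn K M hM e he h => ?_⟩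
    obtain ⟨q, hq, hb, hz⟩ := hih n hn K M hM e he h
    have hn' : (0 : ℝ) < n := by exact_mod_cast hn
    set e1 : ℝ → ℝ := fun t => e t - q t with he1
    have he1m : e1 ∈ Tr (max K l) :=
      Tr_sub (Tr_mono (le_max_left _ _) he) (Tr_mono (le_max_right _ _) hq)
    set x := iteratedDeriv l e1 0 / l.factorial with hx
    set y := (-1) ^ l * iteratedDeriv l e1 π / l.factorial with hy
    have hf1 : (1 : ℝ) ≤ l.factorial := by exact_mod_cast Nat.factorial_pos l
    set B := C * M * n ^ l * (1 / n) ^ j with hB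
    have hB0 : 0 ≤ B := by positivity
    have hxB : |x| ≤ B := by
      have := hb l (by omega) 0
      rw [sw_at_zero sin_zero] at this
      rw [hx, abs_div, Nat.abs_cast]
      exact (div_le_self (abs_nonneg _) hf1).trans this
    have hyB : |y| ≤ B := by
      have := hb l (by omega) π
      rw [sw_at_zero sin_pi] at this
      rw [hy, abs_div, Nat.abs_cast, abs_mul, abs_pow]
      simp only [abs_neg, abs_one, one_pow, one_mul]
      exact (div_le_self (abs_nonneg _) hf1).trans this
    have hqd : (fun t => sin t ^ l * ((x + y) / 2 * 1 + (x - y) / 2 * cos t)) ∈ Tr (l + 1) := by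
      have := Tr_mul (Tr_pow Tr_sin1 l) (Tr_add (Tr_const 1 ((x + y) / 2 * 1)) (Tr_smul ((x - y) / 2) Tr_cos1))
      simpa using this
    have hqi : ∀ i t, iteratedDeriv i (fun t => sin t ^ l * ((x + y) / 2 * 1 + (x - y) / 2 * cos t)) t =
        (x + y) / 2 * iteratedDeriv i (fun t => sin t ^ l * 1) t +
        (x - y) / 2 * iteratedDeriv i (fun t => sin t ^ l * cos t) t := by
      intro i t
      have hu := Tr_mul (Tr_pow Tr_sin1 l) (Tr_const 1 1)
      have hv := Tr_mul (Tr_pow Tr_sin1 l) Tr_cos1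
      have : (fun t => sin t ^ l * ((x + y) / 2 * 1 + (x - y) / 2 * cos t)) =
        fun t => (x + y) / 2 * (sin t ^ l * 1) + (x - y) / 2 * (sin t ^ l * cos t) := by
        funext t; ring
      rw [this, iter_add (Tr_smul _ hu) (Tr_smul _ hv), iteratedDeriv_const_mul_field, iteratedDeriv_const_mul_field]
    have heq : (fun t => e t - (q t + sin t ^ l * ((x + y) / 2 * 1 + (x - y) / 2 * cos t))) =
        fun t => e1 t - sin t ^ l * ((x + y) / 2 * 1 + (x - y) / 2 * cos t) := by
      funext t; simp only [he1]; ring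
    refine ⟨fun t => q t + sin t ^ l * ((x + y) / 2 * 1 + (x - y) / 2 * cos t),
      Tr_add (Tr_mono (by omega) hq) hqd, ?_, ?_⟩
    · intro i hi t
      rw [heq, iter_sub he1m hqd]
      have h1 := hb i hi t
      have hs := sw_nonneg n t
      have hsp := sw_pos hn t
      have h2 : |iteratedDeriv i (fun t => sin t ^ l * ((x + y) / 2 * 1 + (x - y) / 2 * cos t)) t| ≤
          B * (A * sw n t ^ (l - i)) := by
        rw [hqi]
        refine (abs_add_le _ _).trans ?_
        rw [abs_mul, abs_mul]
        have a1 : |(x + y) / 2| ≤ B := by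
          rw [abs_div, abs_two]; linarith [abs_add_le x y]
        have a2 : |(x - y) / 2| ≤ B := by
          rw [abs_div, abs_two]; linarith [abs_sub x y]
        have a3 : |sin t| ^ (l - i) ≤ sw n t ^ (l - i) := by gcongr; exact sin_le_sw n t
        calc _ ≤ B * (Au i * sw n t ^ (l - i)) + B * (Av i * sw n t ^ (l - i)) := by
              gcongr
              · exact (hAu i t).trans (mul_le_mul_of_nonneg_left a3 (hAu0 i))
              · exact (hAv i t).trans (mul_le_mul_of_nonneg_left a3 (hAv0 i))
          _ = B * ((Au i + Av i) * sw n t ^ (l - i)) := by ring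
          _ ≤ _ := by gcongr; exact hAi i hi
      have h3 : (n : ℝ) ^ l * (1 / n) ^ j * sw n t ^ (l - i) ≤ n ^ i * sw n t ^ j := by
        -- multiply out
        have h4 := inv_le_sw n t
        rcases le_total i l with hil | hil
        · have e1 : (n : ℝ) ^ l * (1 / n) ^ j = n ^ i * (1 / n) ^ (j - (l - i)) := by
            rw [show j = (j - (l - i)) + (l - i) by omega, pow_add, show (n : ℝ) ^ l = n ^ (i + (l - i)) by congr 1; omega, pow_add]
            rw [Nat.add_sub_cancel, one_div_pow (n : ℝ) (l - i)]; field_simp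
          rw [e1, mul_assoc]
          gcongr
          calc (1 / (n : ℝ)) ^ (j - (l - i)) * sw n t ^ (l - i) ≤ sw n t ^ (j - (l - i)) * sw n t ^ (l - i) := by gcongr
            _ = _ := by rw [← pow_add]; congr 1; omega
        · rw [Nat.sub_eq_zero_of_le hil, pow_zero, mul_one]
          gcongr
          exact_mod_cast hn
      refine (abs_sub _ _).trans ?_
      calc _ ≤ C * M * n ^ i * sw n t ^ j + C * M * A * (n ^ l * (1 / n) ^ j * sw n t ^ (l - i)) := by
            refine add_le_add h1 (h2.trans (le_of_eq ?_)); rw [hB]; ring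
        _ ≤ C * M * n ^ i * sw n t ^ j + C * M * A * (n ^ i * sw n t ^ j) := by gcongr
        _ = _ := by ring
    · intro i hi
      have hv : ∀ t0, sin t0 = 0 → i < l → iteratedDeriv i (fun t => sin t ^ l *
          ((x + y) / 2 * 1 + (x - y) / 2 * cos t)) t0 = 0 := by
        intro t0 ht0 hil
        have b1 := hAu i t0
        have b2 := hAv i t0
        rw [ht0, abs_zero, zero_pow (by omega), mul_zero] at b1 b2
        rw [hqi, abs_nonpos_iff.1 b1, abs_nonpos_iff.1 b2]; ring
      have hmem := Tr_add (Tr_const 1 ((x + y) / 2 * 1)) (Tr_smul ((x - y) / 2) Tr_cos1)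
      rw [heq, iter_sub he1m hqd, iter_sub he1m hqd]
      rcases Nat.lt_or_ge i l with hil | hil
      · rw [hv 0 sin_zero hil, hv π sin_pi hil, (hz i hil).1, (hz i hil).2]; simp
      · obtain rfl : i = l := by omega
        rw [sin_pow_iter i 1 hmem sin_zero, sin_pow_iter i 1 hmem sin_pi, cos_zero, cos_pi]
        have hne : (i.factorial : ℝ) ≠ 0 := by positivity
        have hx' : iteratedDeriv i e1 0 = i.factorial * x := by rw [hx]; field_simp
        have hy' : iteratedDeriv i e1 π = i.factorial * (-1) ^ i * y := by
          rw [hy]; field_simp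
          rw [← pow_mul, mul_comm i 2, pow_mul]; simp
        rw [hx', hy', one_pow]
        constructor <;> ring

theorem correction (j : ℕ) : ∃ C : ℝ, 0 ≤ C ∧ ∀ n : ℕ, 1 ≤ n → ∀ K : ℕ, ∀ M : ℝ, 0 ≤ M →
    ∀ e ∈ Tr K, (∀ i ≤ j, ∀ t, |iteratedDeriv i e t| ≤ M * n ^ i * sw n t ^ j) →
    ∃ q ∈ Tr j, ∀ t, |e t - q t| ≤ C * M * |sin t| ^ j := by
  obtain ⟨C, hC, haux⟩ := corr_aux j j le_rfl
  refine ⟨C * 6 ^ j, by positivity, fun n hn K M hM e he h => ?_⟩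
  obtain ⟨q, hq, hb, hz⟩ := haux n hn K M hM e he h
  refine ⟨q, hq, fun t => ?_⟩
  have hn' : (0 : ℝ) < n := by exact_mod_cast hn
  set e1 : ℝ → ℝ := fun t => e t - q t with he1
  have he1m : e1 ∈ Tr (max K j) :=
    Tr_sub (Tr_mono (le_max_left _ _) he) (Tr_mono (le_max_right _ _) hq)
  rcases le_total (1 / (n : ℝ)) |sin t| with hs | hs
  · have h1 := hb 0 (Nat.zero_le _) t
    simp only [iteratedDeriv_zero, pow_zero, mul_one] at h1
    have h2 : sw n t ≤ 6 * |sin t| := by unfold sw; linarith [abs_nonneg (sin t)]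
    calc |e t - q t| ≤ C * M * sw n t ^ j := h1
      _ ≤ C * M * (6 * |sin t|) ^ j := by gcongr; exact sw_nonneg _ _
      _ = _ := by rw [mul_pow]; ring
  · set k := round (t / π) with hk
    set t0 := (k : ℝ) * π with ht0
    have hπ := pi_pos
    have hd : |t - t0| ≤ π / 2 := by
      have h1 := abs_sub_round (t / π)
      rw [← hk] at h1
      have h2 : t - t0 = (t / π - k) * π := by rw [ht0]; field_simp
      rw [h2, abs_mul, abs_of_pos hπ]
      nlinarith
    have hsin : |sin (t - t0)| = |sin t| := by
      rw [ht0, sin_sub_int_mul_pi, abs_mul]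
      simp [abs_zpow]
    have hlow : |t - t0| ≤ 2 * |sin t| := by
      have h1 := mul_abs_le_abs_sin hd
      rw [hsin] at h1
      have h2 : (1 : ℝ) / 2 ≤ 2 / π := by rw [div_le_div_iff₀ (by norm_num) hπ]; linarith [pi_le_four]
      nlinarith [abs_nonneg (t - t0)]
    have hz' : ∀ i < j, iteratedDeriv i e1 t0 = 0 := by
      intro i hi
      have hp := Tr_periodic (Tr_iter he1m i)
      rcases Int.even_or_odd' k with ⟨m, hm | hm⟩
      · have := hp.int_mul_eq m
        rw [ht0, hm]
        rw [show ((2 * m : ℤ) : ℝ) * π = m * (2 * π) by push_cast; ring, this]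
        exact (hz i hi).1
      · have := hp.int_mul m π
        rw [ht0, hm]
        rw [show ((2 * m + 1 : ℤ) : ℝ) * π = π + m * (2 * π) by push_cast; ring, this]
        exact (hz i hi).2
    have hmain : ∀ m ≤ j, ∀ x ∈ Set.uIcc t0 t, |iteratedDeriv (j - m) e1 x| ≤
        C * M * 3 ^ j * |t - t0| ^ m := by
      intro m
      induction m with
      | zero =>
        intro _ x hx
        have h1 := hb j le_rfl x
        have h2 : |sin x| ≤ 2 / n := by
          have h3 : |sin x| = |sin (x - t0)| := by
            rw [ht0, sin_sub_int_mul_pi, abs_mul]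
            simp [abs_zpow]
          have h4 : |x - t0| ≤ |t - t0| := Set.abs_sub_left_of_mem_uIcc hx
          have h5 : |sin (x - t0)| ≤ |x - t0| := Real.abs_sin_le_abs
          have h6 : 2 / (n : ℝ) = 2 * (1 / n) := by ring
          rw [h3, h6]; linarith
        have h3 : sw n x ≤ 3 / n := by
          unfold sw
          have : (3 : ℝ) / n = 2 / n + 1 / n := by ring
          linarith
        calc _ ≤ C * M * n ^ j * sw n x ^ j := h1
          _ ≤ C * M * n ^ j * (3 / n) ^ j := by gcongr; exact sw_nonneg _ _
          _ = _ := by rw [div_pow]; field_simp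
      | succ m ihm =>
        intro hm x hx
        have hmv := (convex_uIcc t0 t).norm_image_sub_le_of_norm_hasDerivWithin_le
          (f := iteratedDeriv (j - (m + 1)) e1) (f' := iteratedDeriv (j - m) e1)
          (C := C * M * 3 ^ j * |t - t0| ^ m)
          (fun y _ => by
            have := Tr_hasDerivAt he1m (j - (m + 1)) y
            rw [show j - (m + 1) + 1 = j - m by omega] at this
            exact this.hasDerivWithinAt)
          (fun y hy => ihm (by omega) y hy) Set.left_mem_uIcc hx
        rw [hz' _ (by omega), sub_zero, Real.norm_eq_abs, Real.norm_eq_abs] at hmv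
        refine hmv.trans ?_
        rw [pow_succ, ← mul_assoc]
        exact mul_le_mul_of_nonneg_left (Set.abs_sub_left_of_mem_uIcc hx) (by positivity)
    have := hmain j le_rfl t Set.right_mem_uIcc
    rw [Nat.sub_self, iteratedDeriv_zero] at this
    calc |e t - q t| ≤ _ := this
      _ ≤ C * M * 3 ^ j * (2 * |sin t|) ^ j := by gcongr
      _ = _ := by rw [mul_pow, show (6 : ℝ) = 3 * 2 by norm_num, mul_pow]; ring

end Trigub

namespace Trigub

/-- The Poisson kernel (with `q = exp (-x)`). -/
noncomputable def Pk (x u : ℝ) : ℝ := sinh x / (cosh x - cos u)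

theorem Pk_den {x : ℝ} (hx : 0 < x) (u : ℝ) : 0 < cosh x - cos u := by
  have h1 : 1 < cosh x := one_lt_cosh.2 hx.ne'
  linarith [cos_le_one u]

theorem Pk_nonneg {x : ℝ} (hx : 0 < x) (u : ℝ) : 0 ≤ Pk x u :=
  div_nonneg (sinh_pos_iff.2 hx).le (Pk_den hx u).le

theorem Pk_cont {x : ℝ} (hx : 0 < x) : Continuous (Pk x) := by
  unfold Pk
  exact Continuous.div (by fun_prop) (by fun_prop) fun u => (Pk_den hx u).ne'

theorem Pk_even (x u : ℝ) : Pk x (-u) = Pk x u := by simp [Pk]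

theorem Pk_mul {x : ℝ} (hx : 0 < x) (u : ℝ) : (cosh x - cos u) * Pk x u = sinh x := by
  unfold Pk; rw [mul_div_cancel₀ _ (Pk_den hx u).ne']

theorem Pk_moment {x : ℝ} (hx : 0 < x) (m : ℕ) :
    ∫ u in (-π)..π, cos (m * u) * Pk x u = 2 * π * exp (-(m * x)) := by
  have hc := Pk_cont hx
  have hπ := pi_pos
  set A : ℕ → ℝ := fun m => ∫ u in (-π)..π, cos (m * u) * Pk x u with hA
  have hbd : ∀ m, |A m| ≤ A 0 := by
    intro m
    simp only [hA]
    rw [← Real.norm_eq_abs]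
    refine intervalIntegral.norm_integral_le_of_norm_le (by linarith) ?_
      (Continuous.intervalIntegrable (by fun_prop) _ _)
    refine Filter.Eventually.of_forall fun u _ => ?_
    rw [norm_mul, Real.norm_eq_abs, Real.norm_eq_abs, abs_of_nonneg (Pk_nonneg hx u)]
    simp only [Nat.cast_zero, zero_mul, cos_zero]
    exact mul_le_mul_of_nonneg_right (abs_cos_le_one _) (Pk_nonneg hx u)
  have hrec : ∀ m, A (m + 2) = 2 * cosh x * A (m + 1) - A m := by
    intro m
    have h1 : ∫ u in (-π)..π, cos ((m + 1 : ℕ) * u) * sinh x = 0 := by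
      rw [intervalIntegral.integral_mul_const, integral_cos_nat (by omega), zero_mul]
    have h2 : ∀ u, cos ((m + 1 : ℕ) * u) * sinh x =
        cosh x * (cos ((m + 1 : ℕ) * u) * Pk x u) - (1 / 2) * (cos ((m + 2 : ℕ) * u) * Pk x u) -
          (1 / 2) * (cos (m * u) * Pk x u) := by
      intro u
      rw [← Pk_mul hx u]
      have : cos ((m + 2 : ℕ) * u) + cos (m * u) = 2 * cos ((m + 1 : ℕ) * u) * cos u := by
        rw [show ((m + 2 : ℕ) : ℝ) * u = (m + 1 : ℕ) * u + u by push_cast; ring,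
          show (m : ℝ) * u = (m + 1 : ℕ) * u - u by push_cast; ring, cos_add, cos_sub]; ring
      linear_combination (1 / 2) * Pk x u * this
    simp only [h2] at h1
    rw [intervalIntegral.integral_sub (Continuous.intervalIntegrable (by fun_prop) _ _)
      (Continuous.intervalIntegrable (by fun_prop) _ _),
      intervalIntegral.integral_sub (Continuous.intervalIntegrable (by fun_prop) _ _)
      (Continuous.intervalIntegrable (by fun_prop) _ _), intervalIntegral.integral_const_mul,
      intervalIntegral.integral_const_mul, intervalIntegral.integral_const_mul] at h1
    simp only [hA]
    linarith
  have hrec0 : A 1 = cosh x * A 0 - 2 * π * sinh x := by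
    have h1 : ∫ u in (-π)..π, cos ((0 : ℕ) * u) * sinh x = 2 * π * sinh x := by
      simp; left; ring
    have h2 : ∀ u, cos ((0 : ℕ) * u) * sinh x =
        cosh x * (cos ((0 : ℕ) * u) * Pk x u) - cos ((1 : ℕ) * u) * Pk x u := by
      intro u
      rw [← Pk_mul hx u]
      simp; ring
    simp only [h2] at h1
    rw [intervalIntegral.integral_sub (Continuous.intervalIntegrable (by fun_prop) _ _)
      (Continuous.intervalIntegrable (by fun_prop) _ _), intervalIntegral.integral_const_mul] at h1
    simp only [hA]
    linarith
  have hq : exp (-x) * exp x = 1 := by rw [← exp_add]; simp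
  have hd : ∀ m, A (m + 1) - exp (-x) * A m = exp (m * x) * (A 1 - exp (-x) * A 0) := by
    intro m
    induction m with
    | zero => simp
    | succ m ih =>
      rw [hrec, show ((m + 1 : ℕ) : ℝ) * x = m * x + x by push_cast; ring, exp_add, cosh_eq]
      linear_combination exp x * ih + (A m) * hq
  have hd0 : A 1 - exp (-x) * A 0 = 0 := by
    by_contra hne
    have hpos : 0 < |A 1 - exp (-x) * A 0| := abs_pos.2 hne
    have hA0 : 0 ≤ A 0 := (abs_nonneg _).trans (hbd 0)
    obtain ⟨m, hm⟩ := exists_nat_gt (2 * A 0 / (x * |A 1 - exp (-x) * A 0|))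
    have h1 := hd m
    have h2 : |A (m + 1) - exp (-x) * A m| ≤ 2 * A 0 := by
      refine (abs_sub _ _).trans ?_
      rw [abs_mul, abs_of_pos (exp_pos _)]
      have : exp (-x) ≤ 1 := exp_le_one_iff.2 (by linarith)
      nlinarith [hbd (m + 1), hbd m, abs_nonneg (A m)]
    rw [h1, abs_mul, abs_of_pos (exp_pos _)] at h2
    rw [div_lt_iff₀ (by positivity)] at hm
    have h3 := add_one_le_exp (m * x)
    nlinarith
  have hA0 : A 0 = 2 * π := by
    have hs : 0 < sinh x := sinh_pos_iff.2 hx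
    have h1 : cosh x - exp (-x) = sinh x := by rw [cosh_eq, sinh_eq]; ring
    have : sinh x * (A 0 - 2 * π) = 0 := by
      rw [← h1]; rw [hrec0] at hd0; rw [← h1] at hd0; linarith
    rcases mul_eq_zero.1 this with h | h
    · linarith
    · linarith
  change A m = _
  induction m with
  | zero => simp [hA0]
  | succ m ih =>
    have := hd m
    rw [hd0, mul_zero, ih] at this
    rw [show -(((m + 1 : ℕ) : ℝ) * x) = -(m * x) + -x by push_cast; ring, exp_add]
    linarith

theorem Pk_moment_phase {x : ℝ} (hx : 0 < x) (m : ℕ) (φ : ℝ) :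
    ∫ u in (-π)..π, cos (φ + m * u) * Pk x u = 2 * π * cos φ * exp (-(m * x)) := by
  have hc := Pk_cont hx
  have hodd : ∫ u in (-π)..π, sin (m * u) * Pk x u = 0 := by
    have := intervalIntegral.integral_comp_neg (a := -π) (b := π) (fun u => sin (m * u) * Pk x u)
    simp only [Pk_even, neg_neg, mul_neg, sin_neg, neg_mul, intervalIntegral.integral_neg] at this
    linarith
  have h2 : ∀ u, cos (φ + m * u) * Pk x u = cos φ * (cos (m * u) * Pk x u) -
      sin φ * (sin (m * u) * Pk x u) := fun u => by rw [cos_add]; ring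
  simp only [h2]
  rw [intervalIntegral.integral_sub (Continuous.intervalIntegrable (by fun_prop) _ _)
      (Continuous.intervalIntegrable (by fun_prop) _ _), intervalIntegral.integral_const_mul,
      intervalIntegral.integral_const_mul, hodd, Pk_moment hx]
  ring

theorem Pk_moment_phase' {x : ℝ} (hx : 0 < x) (m : ℕ) (φ : ℝ) :
    ∫ u in (-π)..π, cos (φ - m * u) * Pk x u = 2 * π * cos φ * exp (-(m * x)) := by
  have := Pk_moment_phase hx m (-φ)
  rw [cos_neg] at this
  rw [← this]
  refine intervalIntegral.integral_congr fun u _ => ?_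
  rw [← cos_neg]; congr 2; ring

/-- Reduction of frequency `N` to frequency `1`, for trigonometric polynomials. -/
theorem Pk_scale_Tr {x : ℝ} (hx : 0 < x) {N : ℕ} (hN : 1 ≤ N) (φ : ℝ) {d : ℕ} {T : ℝ → ℝ} (hT : T ∈ Tr d) :
    ∫ u in (-π)..π, T (N * u - φ) * Pk x u = ∫ u in (-π)..π, T (u - φ) * Pk (N * x) u := by
  have hN' : (0 : ℝ) < N := by exact_mod_cast hN
  have hNx : 0 < N * x := by positivity
  have hc := Pk_cont hx
  have hc' := Pk_cont hNx
  have key : ∀ (k : ℕ) (θ : ℝ), ∫ u in (-π)..π, cos (k * (N * u - φ) + θ) * Pk x u =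
      ∫ u in (-π)..π, cos (k * (u - φ) + θ) * Pk (N * x) u := by
    intro k θ
    have h1 := Pk_moment_phase hx (k * N) (θ - k * φ)
    have h2 := Pk_moment_phase hNx k (θ - k * φ)
    have e : -(((k * N : ℕ) : ℝ) * x) = -(k * (N * x)) := by push_cast; ring
    rw [e, ← h2] at h1
    convert h1 using 5 <;> push_cast <;> ring_nf
  refine Tr_induction (P := fun T => ∫ u in (-π)..π, T (N * u - φ) * Pk x u =
    ∫ u in (-π)..π, T (u - φ) * Pk (N * x) u) ?_ ?_ ?_ ?_ hT
  · intro k _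
    simpa using key k 0
  · intro k _
    have := key k (-(π / 2))
    simpa only [← sub_eq_add_neg, cos_sub_pi_div_two] using this
  · intro f g hf hg h1 h2
    have hfc := Tr_cont hf
    have hgc := Tr_cont hg
    simp only [add_mul]
    rw [intervalIntegral.integral_add (Continuous.intervalIntegrable (by fun_prop) _ _)
      (Continuous.intervalIntegrable (by fun_prop) _ _),
      intervalIntegral.integral_add (Continuous.intervalIntegrable (by fun_prop) _ _)
      (Continuous.intervalIntegrable (by fun_prop) _ _), h1, h2]
  · intro c f hf h
    simp only [mul_assoc, intervalIntegral.integral_const_mul] at h ⊢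
    rw [h]

theorem Pk_scale {x : ℝ} (hx : 0 < x) {N : ℕ} (hN : 1 ≤ N) (φ : ℝ) :
    ∫ u in (-π)..π, |cos (N * u - φ)| * Pk x u = ∫ u in (-π)..π, |cos (u - φ)| * Pk (N * x) u := by
  have hN' : (0 : ℝ) < N := by exact_mod_cast hN
  have hNx : 0 < N * x := by positivity
  have hc := Pk_cont hx
  have hc' := Pk_cont hNx
  have hπ := pi_pos
  have hmass : ∀ {y : ℝ}, 0 < y → ∫ u in (-π)..π, Pk y u = 2 * π := fun hy => by
    have := Pk_moment hy 0
    simpa using this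
  have hdiff : ∀ ε > 0, |(∫ u in (-π)..π, |cos (N * u - φ)| * Pk x u) -
      ∫ u in (-π)..π, |cos (u - φ)| * Pk (N * x) u| ≤ ε * (4 * π) := by
    intro ε hε
    obtain ⟨p, hp⟩ := exists_polynomial_near_of_continuousOn (-1) 1 (fun x => |x|)
      continuous_abs.continuousOn ε hε
    have hT := Tr_poly p le_rfl
    have hTs := Pk_scale_Tr hx hN φ hT
    have hest : ∀ (v : ℝ → ℝ) (y : ℝ), Continuous v → 0 < y →
        |(∫ u in (-π)..π, |cos (v u)| * Pk y u) - ∫ u in (-π)..π, p.eval (cos (v u)) * Pk y u| ≤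
        ε * (2 * π) := by
      intro v y hv hy
      have hcy := Pk_cont hy
      have hpc : Continuous (fun u => p.eval (cos (v u))) :=
        p.continuous.comp (continuous_cos.comp hv)
      rw [← intervalIntegral.integral_sub (Continuous.intervalIntegrable (by fun_prop) _ _)
        (Continuous.intervalIntegrable (by fun_prop) _ _), ← hmass hy,
        ← intervalIntegral.integral_const_mul, ← Real.norm_eq_abs]
      refine intervalIntegral.norm_integral_le_of_norm_le (by linarith) ?_
        (Continuous.intervalIntegrable (by fun_prop) _ _)
      refine Filter.Eventually.of_forall fun u _ => ?_
      rw [← sub_mul, norm_mul, Real.norm_eq_abs, Real.norm_eq_abs, abs_of_nonneg (Pk_nonneg hy u)]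
      refine mul_le_mul_of_nonneg_right ?_ (Pk_nonneg hy u)
      rw [abs_sub_comm]
      exact (hp _ ⟨neg_one_le_cos _, cos_le_one _⟩).le
    have h1 := hest (fun u => N * u - φ) x (by fun_prop) hx
    have h2 := hest (fun u => u - φ) (N * x) (by fun_prop) hNx
    rw [hTs] at h1
    rw [abs_sub_comm] at h2
    have := abs_sub_le (∫ u in (-π)..π, |cos (N * u - φ)| * Pk x u)
      (∫ u in (-π)..π, p.eval (cos (u - φ)) * Pk (N * x) u)
      (∫ u in (-π)..π, |cos (u - φ)| * Pk (N * x) u)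
    linarith
  have h0 : |(∫ u in (-π)..π, |cos (N * u - φ)| * Pk x u) -
      ∫ u in (-π)..π, |cos (u - φ)| * Pk (N * x) u| ≤ 0 := by
    refine le_of_forall_pos_le_add fun δ hδ => ?_
    have := hdiff (δ / (4 * π)) (by positivity)
    rw [div_mul_cancel₀ _ (by positivity)] at this
    linarith
  exact sub_eq_zero.1 (abs_nonpos_iff.1 h0)

theorem int_abs_cos {x : ℝ} (hx : 0 < x) :
    ∫ u in (-π)..π, |cos u| * Pk x u = 4 * cosh x * arctan (1 / sinh x) := by
  have hc := Pk_cont hx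
  have hπ := pi_pos
  have hs : 0 < sinh x := sinh_pos_iff.2 hx
  have hper : Function.Periodic (fun u => |cos u| * Pk x u) (2 * π) := fun u => by
    simp [Pk, cos_add_two_pi]
  have h1 := hper.intervalIntegral_add_eq (-π) (-(π / 2))
  rw [show -π + 2 * π = π by ring, show -(π / 2) + 2 * π = 3 * π / 2 by ring] at h1
  rw [h1, ← intervalIntegral.integral_add_adjacent_intervals (b := π / 2)
    (Continuous.intervalIntegrable (by fun_prop) _ _) (Continuous.intervalIntegrable (by fun_prop) _ _)]
  have h2 : ∫ u in (π / 2)..(3 * π / 2), |cos u| * Pk x u =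
      ∫ u in (-(π / 2))..(π / 2), |cos (u + π)| * Pk x (u + π) := by
    rw [intervalIntegral.integral_comp_add_right (fun u => |cos u| * Pk x u)]
    congr 1 <;> ring
  rw [h2]
  rw [← intervalIntegral.integral_add (Continuous.intervalIntegrable (by fun_prop) _ _)
    (Continuous.intervalIntegrable (by fun_prop) _ _)]
  have hder : ∀ u ∈ Set.uIcc (-(π / 2)) (π / 2),
      HasDerivAt (fun u => 2 * cosh x * arctan (sin u / sinh x))
      (|cos u| * Pk x u + |cos (u + π)| * Pk x (u + π)) u := by
    intro u hu
    rw [Set.uIcc_of_le (by linarith)] at hu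
    have hcu : 0 ≤ cos u := cos_nonneg_of_mem_Icc hu
    have hd := (((hasDerivAt_sin u).div_const (sinh x)).arctan).const_mul (2 * cosh x)
    refine hd.congr_deriv ?_
    rw [cos_add_pi, abs_neg, abs_of_nonneg hcu]
    unfold Pk
    rw [cos_add_pi]
    have d1 := Pk_den hx u
    have d2 := Pk_den hx (u + π)
    rw [cos_add_pi] at d2
    have e1 : (cosh x - cos u) * (cosh x - -cos u) = sinh x ^ 2 + sin u ^ 2 := by
      have a := cosh_sq x
      have b := sin_sq_add_cos_sq u
      linear_combination a - b
    have e2 : 1 + (sin u / sinh x) ^ 2 = (cosh x - cos u) * (cosh x - -cos u) / sinh x ^ 2 := by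
      rw [e1]; field_simp
    rw [e2]
    field_simp
    ring
  rw [intervalIntegral.integral_eq_sub_of_hasDerivAt hder
    (Continuous.intervalIntegrable (by fun_prop) _ _), sin_neg, sin_pi_div_two, neg_div, arctan_neg]
  ring

theorem int_abs_sin {x : ℝ} (hx : 0 < x) :
    ∫ u in (-π)..π, |sin u| * Pk x u = 2 * sinh x * log ((cosh x + 1) / (cosh x - 1)) := by
  have hc := Pk_cont hx
  have hπ := pi_pos
  have hs : 0 < sinh x := sinh_pos_iff.2 hx
  have hch : 1 < cosh x := one_lt_cosh.2 hx.ne'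
  rw [← intervalIntegral.integral_add_adjacent_intervals (b := 0)
    (Continuous.intervalIntegrable (by fun_prop) _ _) (Continuous.intervalIntegrable (by fun_prop) _ _)]
  have h1 : ∫ u in (-π)..0, |sin u| * Pk x u = ∫ u in (0)..π, |sin u| * Pk x u := by
    have := intervalIntegral.integral_comp_neg (a := 0) (b := π) (fun u => |sin u| * Pk x u)
    simp only [Pk_even, sin_neg, abs_neg, neg_zero] at this
    exact this.symm
  have hder : ∀ u ∈ Set.uIcc 0 π, HasDerivAt (fun u => sinh x * log (cosh x - cos u))
      (|sin u| * Pk x u) u := by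
    intro u hu
    rw [Set.uIcc_of_le hπ.le] at hu
    have hd := (((hasDerivAt_cos u).const_sub (cosh x)).log (Pk_den hx u).ne').const_mul (sinh x)
    refine hd.congr_deriv ?_
    rw [abs_of_nonneg (sin_nonneg_of_mem_Icc hu)]
    unfold Pk; ring
  rw [h1, intervalIntegral.integral_eq_sub_of_hasDerivAt hder
    (Continuous.intervalIntegrable (by fun_prop) _ _), cos_pi, cos_zero, sub_neg_eq_add,
    log_div (by linarith) (by linarith)]
  ring

end Trigub

namespace Trigub

/-- `cosh y` or `sinh y` according to the parity of `r`. -/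
noncomputable def hh (r : ℕ) (y : ℝ) : ℝ := (exp y + (-1) ^ r * exp (-y)) / 2

theorem hh_pos (r : ℕ) {y : ℝ} (hy : 0 < y) : 0 < hh r y := by
  have h1 : exp (-y) < exp y := exp_lt_exp.2 (by linarith)
  have h2 := exp_pos (-y)
  unfold hh
  rcases neg_one_pow_eq_or ℝ r with h | h <;> rw [h] <;> linarith

/-- The multipliers of the Favard kernel. -/
noncomputable def kap (r N k : ℕ) (x : ℝ) : ℝ :=
  (exp (-(|(N : ℝ) - k| * x)) + (-1) ^ r * exp (-((N + k : ℝ) * x))) / (2 * hh r (N * x))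

/-- The `λ`-slice of the Favard error functional. -/
noncomputable def Ef (r N : ℕ) (ψ : ℝ → ℝ) (t x : ℝ) : ℝ :=
  (∫ u in (-π)..π, ψ (t - u) * (cos (N * u - r * (π / 2)) * Pk x u)) / (2 * π * hh r (N * x))

theorem cos_add_r (r : ℕ) (y : ℝ) : cos (y + r * (π / 2)) = (-1) ^ r * cos (y - r * (π / 2)) := by
  have := cos_add_nat_mul_pi (y - r * (π / 2)) r
  rw [← this]; congr 1; ring

theorem Ef_cos {r N k : ℕ} {φ t x : ℝ} (hx : 0 < x) :
    Ef r N (fun s => cos (k * s + φ)) t x = cos (k * t + φ - r * (π / 2)) * kap r N k x := by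
  have hc := Pk_cont hx
  have hπ := pi_pos
  have h1 : ∀ u, cos (k * (t - u) + φ) * (cos (N * u - r * (π / 2)) * Pk x u) =
      (1 / 2) * (cos (k * t + φ - r * (π / 2) + ((N : ℝ) - k) * u) * Pk x u) +
      (1 / 2) * (cos (k * t + φ + r * (π / 2) - (k + N : ℕ) * u) * Pk x u) := by
    intro u
    rw [show k * t + φ - r * (π / 2) + ((N : ℝ) - k) * u =
      (k * (t - u) + φ) + (N * u - r * (π / 2)) by ring,
      show k * t + φ + r * (π / 2) - (k + N : ℕ) * u =
      (k * (t - u) + φ) - (N * u - r * (π / 2)) by push_cast; ring, cos_add (k * (t - u) + φ) (N * u - r * (π / 2)), cos_sub (k * (t - u) + φ) (N * u - r * (π / 2))]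
    ring
  have h2 : ∀ θ : ℝ, ∫ u in (-π)..π, cos (θ + ((N : ℝ) - k) * u) * Pk x u =
      2 * π * cos θ * exp (-(|(N : ℝ) - k| * x)) := by
    intro θ
    rcases le_total k N with h | h
    · have := Pk_moment_phase hx (N - k) θ
      rw [Nat.cast_sub h] at this
      rw [this, abs_of_nonneg (sub_nonneg.2 (by exact_mod_cast h))]
    · have := Pk_moment_phase' hx (k - N) θ
      rw [Nat.cast_sub h] at this
      rw [abs_of_nonpos (sub_nonpos.2 (by exact_mod_cast h)), neg_sub, ← this]
      refine intervalIntegral.integral_congr fun u _ => ?_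
      congr 2; ring
  unfold Ef kap
  simp only [h1]
  rw [intervalIntegral.integral_add (Continuous.intervalIntegrable (by fun_prop) _ _)
    (Continuous.intervalIntegrable (by fun_prop) _ _), intervalIntegral.integral_const_mul,
    intervalIntegral.integral_const_mul, h2, Pk_moment_phase' hx, cos_add_r,
    show -(((k + N : ℕ) : ℝ) * x) = -(((N : ℝ) + k) * x) by push_cast; ring]
  field_simp

theorem kap_ge {r N k : ℕ} (hN : 1 ≤ N) (hk : N ≤ k) {x : ℝ} (hx : 0 < x) :
    kap r N k x = exp (-(k * x)) := by
  have hN' : (0 : ℝ) < N := by exact_mod_cast hN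
  have h := hh_pos r (mul_pos hN' hx)
  unfold kap
  rw [div_eq_iff (by positivity), abs_of_nonpos (sub_nonpos.2 (by exact_mod_cast hk))]
  unfold hh
  rw [mul_div_cancel₀ _ two_ne_zero, mul_add, ← exp_add, mul_left_comm, ← exp_add]
  congr 2
  · congr 1; ring
  · congr 1; ring

theorem kap_lt {r N k : ℕ} (hN : 1 ≤ N) (hk : k < N) {x : ℝ} (hx : 0 < x) :
    |kap r N k x| ≤ exp (-(N * x)) := by
  have hN' : (0 : ℝ) < N := by exact_mod_cast hN
  have h := hh_pos r (mul_pos hN' hx)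
  have hk' : (k : ℝ) < N := by exact_mod_cast hk
  unfold kap
  rw [abs_div, abs_of_pos (show 0 < 2 * hh r (N * x) by positivity), div_le_iff₀ (by positivity),
    abs_of_nonneg (sub_nonneg.2 hk'.le)]
  unfold hh
  rw [mul_div_cancel₀ _ two_ne_zero]
  have e1 : exp (-(((N : ℝ) - k) * x)) = exp (-(N * x)) * exp (k * x) := by
    rw [← exp_add]; congr 1; ring
  have e2 : exp (-(((N : ℝ) + k) * x)) = exp (-(N * x)) * exp (-(k * x)) := by
    rw [← exp_add]; congr 1; ring
  rw [e1, e2, mul_left_comm, ← mul_add, abs_mul, abs_of_pos (exp_pos _)]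
  refine mul_le_mul_of_nonneg_left ?_ (exp_pos _).le
  have a0 : 1 ≤ exp (k * x) := one_le_exp (by positivity)
  have a1 : exp (k * x) ≤ exp (N * x) := exp_le_exp.2 (by nlinarith)
  have a2 : exp (-(N * x)) ≤ exp (-(k * x)) := exp_le_exp.2 (by nlinarith)
  have b1 : exp (k * x) * exp (-(k * x)) = 1 := by rw [← exp_add]; simp
  have b2 : exp (N * x) * exp (-(N * x)) = 1 := by rw [← exp_add]; simp
  have p1 := exp_pos (-(k * x))
  have p2 := exp_pos (-(N * x))
  have a3 : exp (-(k * x)) ≤ 1 := exp_le_one_iff.2 (by simp; positivity)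
  rcases neg_one_pow_eq_or ℝ r with h | h <;> rw [h]
  · rw [one_mul, one_mul, abs_of_pos (by positivity)]
    set A := exp (k * x)
    set B := exp (N * x)
    set a := exp (-(k * x))
    set b := exp (-(N * x))
    -- (B - A)(1 - a b) ≥ 0
    have : (B - A) * (1 - a * b) = B + b - (A + a) := by
      linear_combination (-a) * b2 + b * b1
    have h5 : 0 ≤ (B - A) * (1 - a * b) := mul_nonneg (by linarith) (by nlinarith)
    linarith
  · rw [abs_of_nonneg (by linarith)]
    linarith

theorem gamma_int (m : ℕ) {a : ℝ} (ha : 0 < a) :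
    MeasureTheory.IntegrableOn (fun x : ℝ => x ^ m / m.factorial * exp (-(a * x))) (Set.Ioi 0) ∧
    ∫ x in Set.Ioi (0 : ℝ), x ^ m / m.factorial * exp (-(a * x)) = 1 / a ^ (m + 1) := by
  have e : (fun x : ℝ => x ^ m / m.factorial * exp (-(a * x))) =
      fun x => (1 / m.factorial) * (x ^ m * exp (-(a * x))) := by funext x; ring
  rw [e]
  constructor
  · refine MeasureTheory.Integrable.const_mul ?_ _
    have := integrableOn_rpow_mul_exp_neg_mul_rpow (p := 1) (s := m) (b := a)
      (by have : (0 : ℝ) ≤ m := by positivity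
          linarith) one_pos ha
    refine (MeasureTheory.integrableOn_congr_fun (fun x hx => ?_) measurableSet_Ioi).1 this
    simp
  · rw [MeasureTheory.integral_const_mul]
    have := integral_rpow_mul_exp_neg_mul_Ioi (a := m + 1) (r := a) (by positivity) ha
    simp only [add_sub_cancel_right, rpow_natCast] at this
    rw [this, Gamma_nat_eq_factorial]
    have h2 : (1 / a) ^ ((m : ℝ) + 1) = 1 / a ^ (m + 1) := by
      have : ((m : ℝ) + 1) = ((m + 1 : ℕ) : ℝ) := by push_cast; ring
      rw [this, rpow_natCast, one_div_pow]
    rw [h2]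
    have : (m.factorial : ℝ) ≠ 0 := by positivity
    field_simp

theorem Tr_cos_phase (k : ℕ) (θ : ℝ) : (fun t => cos (k * t + θ)) ∈ Tr k := by
  have : (fun t : ℝ => cos (k * t + θ)) = fun t => cos θ * cos (k * t) - sin θ * sin (k * t) := by
    funext t; rw [cos_add]; ring
  rw [this]
  exact Tr_sub (Tr_smul _ (Tr_cos le_rfl)) (Tr_smul _ (Tr_sin le_rfl))

theorem iter_cos_phase (r k : ℕ) (θ t : ℝ) :
    iteratedDeriv r (fun t => cos (k * t + θ)) t = k ^ r * cos (k * t + θ + r * (π / 2)) := by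
  induction r generalizing t with
  | zero => simp
  | succ r ih =>
    rw [iteratedDeriv_succ, show iteratedDeriv r (fun t => cos (k * t + θ)) = _ from funext ih]
    have h : HasDerivAt (fun t => (k : ℝ) ^ r * cos (k * t + θ + r * (π / 2)))
        (k ^ r * (-sin (k * t + θ + r * (π / 2)) * (k * 1))) t :=
      (((((hasDerivAt_id t).const_mul (k : ℝ)).add_const θ).add_const (r * (π / 2))).cos).const_mul _
    rw [h.deriv]
    rw [show k * t + θ + ((r + 1 : ℕ) : ℝ) * (π / 2) = k * t + θ + r * (π / 2) + π / 2 by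
      push_cast; ring, cos_add_pi_div_two]
    ring

/-- Representation property used in the Favard lemma (with `r = m + 1`). -/
def FP (m N K : ℕ) (ψ : ℝ → ℝ) : Prop := ∃ F ∈ Tr K, ∃ c : ℝ, ∃ τ ∈ Tr (N - 1),
  (∀ t, iteratedDeriv (m + 1) F t = ψ t - c) ∧
  (∀ t, MeasureTheory.IntegrableOn (fun x => x ^ m / m.factorial * Ef (m + 1) N ψ t x) (Set.Ioi 0)) ∧
  ∀ t, F t - τ t = ∫ x in Set.Ioi (0 : ℝ), x ^ m / m.factorial * Ef (m + 1) N ψ t x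

theorem FP_gen (m N K k : ℕ) (hN : 1 ≤ N) (hk : k ≤ K) (φ : ℝ) : FP m N K (fun s => cos (k * s + φ)) := by
  have hN' : (0 : ℝ) < N := by exact_mod_cast hN
  have hF : ∃ F ∈ Tr k, ∃ c : ℝ, (∀ t, iteratedDeriv (m + 1) F t = cos (k * t + φ) - c) ∧
      (1 ≤ k → ∀ t, F t = 1 / k ^ (m + 1) * cos (k * t + (φ - (m + 1 : ℕ) * (π / 2)))) := by
    rcases Nat.eq_zero_or_pos k with rfl | hk0
    · refine ⟨fun _ => 0, Tr_const _ 0, cos φ, fun t => ?_, fun h => by omega⟩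
      simp [iteratedDeriv_const]
    · refine ⟨fun t => 1 / k ^ (m + 1) * cos (k * t + (φ - (m + 1 : ℕ) * (π / 2))),
        Tr_smul _ (Tr_cos_phase _ _), 0, fun t => ?_, fun _ t => rfl⟩
      rw [iteratedDeriv_const_mul_field, iter_cos_phase]
      have : (k : ℝ) ≠ 0 := by positivity
      rw [show k * t + (φ - (m + 1 : ℕ) * (π / 2)) + (m + 1 : ℕ) * (π / 2) = k * t + φ by ring]
      field_simp; ring
  obtain ⟨F, hF, c, hFd, hFe⟩ := hF
  have hE : ∀ t, Set.EqOn (fun x => x ^ m / m.factorial * Ef (m + 1) N (fun s => cos (k * s + φ)) t x)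
      (fun x => cos (k * t + (φ - (m + 1 : ℕ) * (π / 2))) * (x ^ m / m.factorial * kap (m + 1) N k x))
      (Set.Ioi 0) := by
    intro t x hx
    simp only []
    rw [Ef_cos hx]
    rw [show k * t + φ - (m + 1 : ℕ) * (π / 2) = k * t + (φ - (m + 1 : ℕ) * (π / 2)) by ring]; ring
  have hIntg : MeasureTheory.IntegrableOn (fun x => x ^ m / m.factorial * kap (m + 1) N k x) (Set.Ioi 0) := by
    rcases Nat.lt_or_ge k N with h | h
    · refine MeasureTheory.Integrable.mono' (gamma_int m hN').1 ?_ ?_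
      · refine ContinuousOn.aestronglyMeasurable ?_ measurableSet_Ioi
        unfold kap hh
        refine ContinuousOn.mul (by fun_prop) (ContinuousOn.div (by fun_prop) (by fun_prop) ?_)
        intro x hx
        have := hh_pos (m + 1) (mul_pos hN' hx)
        unfold hh at this
        positivity
      · refine (MeasureTheory.ae_restrict_iff' measurableSet_Ioi).2 (Filter.Eventually.of_forall ?_)
        intro x hx
        have hx' : 0 < x := hx
        rw [norm_mul, Real.norm_eq_abs, Real.norm_eq_abs, abs_of_nonneg (by positivity)]
        gcongr
        exact kap_lt hN h hx
    · refine (MeasureTheory.integrableOn_congr_fun (fun x hx => ?_) measurableSet_Ioi).2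
        (gamma_int m (show (0 : ℝ) < k by exact_mod_cast (by omega : 0 < k))).1
      rw [kap_ge hN h hx]
  set I := ∫ x in Set.Ioi (0 : ℝ), x ^ m / m.factorial * kap (m + 1) N k x with hI
  have hIntg' : ∀ t, MeasureTheory.IntegrableOn
      (fun x => x ^ m / m.factorial * Ef (m + 1) N (fun s => cos (k * s + φ)) t x) (Set.Ioi 0) := fun t =>
    (MeasureTheory.integrableOn_congr_fun (hE t) measurableSet_Ioi).2 (hIntg.const_mul _)
  have hval : ∀ t, ∫ x in Set.Ioi (0 : ℝ),
      x ^ m / m.factorial * Ef (m + 1) N (fun s => cos (k * s + φ)) t x =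
      I * cos (k * t + (φ - (m + 1 : ℕ) * (π / 2))) := fun t => by
    rw [MeasureTheory.setIntegral_congr_fun measurableSet_Ioi (hE t), MeasureTheory.integral_const_mul]
    ring
  rcases Nat.lt_or_ge k N with h | h
  · refine ⟨F, Tr_mono hk hF, c, fun t => F t - I * cos (k * t + (φ - (m + 1 : ℕ) * (π / 2))),
      Tr_mono (by omega) (Tr_sub hF (Tr_smul _ (Tr_cos_phase _ _))), hFd, hIntg', fun t => ?_⟩
    rw [hval]; ring
  · refine ⟨F, Tr_mono hk hF, c, fun t => 0, Tr_const _ 0, hFd, hIntg', fun t => ?_⟩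
    have hk0 : (0 : ℝ) < k := by exact_mod_cast (by omega : 0 < k)
    rw [hval, hFe (by omega), sub_zero]
    congr 1
    rw [hI, ← (gamma_int m hk0).2]
    refine (MeasureTheory.setIntegral_congr_fun measurableSet_Ioi fun x hx => ?_)
    rw [kap_ge hN h hx]

theorem FP_all (m N K : ℕ) (hN : 1 ≤ N) {ψ : ℝ → ℝ} (hψ : ψ ∈ Tr K) : FP m N K ψ := by
  refine Tr_induction (P := FP m N K) ?_ ?_ ?_ ?_ hψ
  · intro k hk; simpa using FP_gen m N K k hN hk 0
  · intro k hk
    simpa only [← sub_eq_add_neg, cos_sub_pi_div_two] using FP_gen m N K k hN hk (-(π / 2))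
  · rintro f g hf hg ⟨F, hF, c, τ, hτ, h1, h2, h3⟩ ⟨F', hF', c', τ', hτ', h1', h2', h3'⟩
    have hE : ∀ t, Set.EqOn (fun x => x ^ m / m.factorial * Ef (m + 1) N (fun s => f s + g s) t x)
        (fun x => x ^ m / m.factorial * Ef (m + 1) N f t x + x ^ m / m.factorial * Ef (m + 1) N g t x)
        (Set.Ioi 0) := by
      intro t x hx
      have hc := Pk_cont hx
      have hfc := Tr_cont hf
      have hgc := Tr_cont hg
      simp only [Ef, add_mul]
      rw [intervalIntegral.integral_add (Continuous.intervalIntegrable (by fun_prop) _ _)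
        (Continuous.intervalIntegrable (by fun_prop) _ _)]
      ring
    refine ⟨fun t => F t + F' t, Tr_add hF hF', c + c', fun t => τ t + τ' t, Tr_add hτ hτ',
      fun t => ?_, fun t => ?_, fun t => ?_⟩
    · rw [iter_add hF hF', h1, h1']; ring
    · exact (MeasureTheory.integrableOn_congr_fun (hE t) measurableSet_Ioi).2 ((h2 t).add (h2' t))
    · rw [MeasureTheory.setIntegral_congr_fun measurableSet_Ioi (hE t),
        MeasureTheory.integral_add (h2 t) (h2' t), ← h3, ← h3']
      ring
  · rintro a f hf ⟨F, hF, c, τ, hτ, h1, h2, h3⟩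
    have hE : ∀ t, Set.EqOn (fun x => x ^ m / m.factorial * Ef (m + 1) N (fun s => a * f s) t x)
        (fun x => a * (x ^ m / m.factorial * Ef (m + 1) N f t x)) (Set.Ioi 0) := by
      intro t x hx
      simp only [Ef, mul_assoc a, intervalIntegral.integral_const_mul]
      ring
    refine ⟨fun t => a * F t, Tr_smul _ hF, a * c, fun t => a * τ t, Tr_smul _ hτ,
      fun t => ?_, fun t => ?_, fun t => ?_⟩
    · rw [iteratedDeriv_const_mul_field, h1]; ring
    · exact (MeasureTheory.integrableOn_congr_fun (hE t) measurableSet_Ioi).2 ((h2 t).const_mul a)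
    · rw [MeasureTheory.setIntegral_congr_fun measurableSet_Ioi (hE t),
        MeasureTheory.integral_const_mul, ← h3]
      ring

end Trigub

namespace Trigub

theorem hasSum_arctan_exp {y : ℝ} (hy : 0 < y) :
    HasSum (fun ν : ℕ => (4 / π) * ((-1) ^ ν * exp (-y) ^ (2 * ν + 1) / (2 * ν + 1)))
      ((4 * cosh y * arctan (1 / sinh y)) / (2 * π * cosh y)) := by
  have hq0 := exp_pos (-y)
  have hq1 : exp (-y) < 1 := exp_lt_one_iff.2 (by linarith)
  have hs := hasSum_arctan (x := exp (-y)) (by rw [Real.norm_eq_abs, abs_of_pos hq0]; exact hq1)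
  have h2 := two_mul_arctan (x := exp (-y)) (by linarith) hq1
  have hsin : 0 < sinh y := sinh_pos_iff.2 hy
  have e1 : exp (-y) * exp y = 1 := by rw [← exp_add]; simp
  have h3 : 2 * exp (-y) / (1 - exp (-y) ^ 2) = 1 / sinh y := by
    have : 1 - exp (-y) ^ 2 = 2 * exp (-y) * sinh y := by
      rw [sinh_eq]; linear_combination (-1) * e1
    rw [this]; field_simp
  rw [h3] at h2
  have := hs.mul_left (4 / π)
  have e2 : (fun ν : ℕ => (4 / π) * ((-1) ^ ν * exp (-y) ^ (2 * ν + 1) / (2 * ν + 1))) =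
      (fun ν : ℕ => (4 / π) * ((-1) ^ ν * exp (-y) ^ (2 * ν + 1) / ((2 * ν + 1 : ℕ) : ℝ))) := by
    funext ν; push_cast; ring
  have e3 : (4 * cosh y * arctan (1 / sinh y)) / (2 * π * cosh y) = 4 / π * arctan (exp (-y)) := by
    rw [← h2]
    have := cosh_pos y
    field_simp
  rw [e2, e3]; exact this

theorem hasSum_log_exp {y : ℝ} (hy : 0 < y) :
    HasSum (fun ν : ℕ => (4 / π) * (exp (-y) ^ (2 * ν + 1) / (2 * ν + 1)))
      ((2 * sinh y * log ((cosh y + 1) / (cosh y - 1))) / (2 * π * sinh y)) := by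
  have hq0 := exp_pos (-y)
  have hq1 : exp (-y) < 1 := exp_lt_one_iff.2 (by linarith)
  have hs := hasSum_log_sub_log_of_abs_lt_one (x := exp (-y)) (by rw [abs_of_pos hq0]; exact hq1)
  have hsin : 0 < sinh y := sinh_pos_iff.2 hy
  have hch : 1 < cosh y := one_lt_cosh.2 hy.ne'
  have e1 : exp (-y) * exp y = 1 := by rw [← exp_add]; simp
  have h3 : (cosh y + 1) / (cosh y - 1) = ((1 + exp (-y)) / (1 - exp (-y))) ^ 2 := by
    rw [div_pow, div_eq_div_iff (by linarith) (by nlinarith), cosh_eq]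
    linear_combination (-2) * e1
  have hl : log ((cosh y + 1) / (cosh y - 1)) = 2 * (log (1 + exp (-y)) - log (1 - exp (-y))) := by
    rw [h3, log_pow, log_div (by linarith) (by linarith)]; norm_num
  have := hs.mul_left (2 / π)
  have e2 : (fun ν : ℕ => (4 / π) * (exp (-y) ^ (2 * ν + 1) / (2 * ν + 1))) =
      (fun ν : ℕ => (2 / π) * (2 * (1 / (2 * (ν : ℝ) + 1)) * exp (-y) ^ (2 * ν + 1))) := by
    funext ν; ring
  have e3 : (2 * sinh y * log ((cosh y + 1) / (cosh y - 1))) / (2 * π * sinh y) =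
      2 / π * (log (1 + exp (-y)) - log (1 - exp (-y))) := by
    rw [hl]; field_simp
  rw [e2, e3]; exact this

theorem hasSum_L1 (r : ℕ) {y : ℝ} (hy : 0 < y) :
    HasSum (fun ν : ℕ => (4 / π) * ((-1) ^ (ν * (r + 1)) * exp (-y) ^ (2 * ν + 1) / (2 * ν + 1)))
      ((∫ u in (-π)..π, |cos (u - r * (π / 2))| * Pk y u) / (2 * π * hh r y)) := by
  rcases Nat.even_or_odd' r with ⟨k, rfl | rfl⟩
  · have e1 : ∀ u, |cos (u - (2 * k : ℕ) * (π / 2))| = |cos u| := fun u => by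
      have : u - (2 * k : ℕ) * (π / 2) = u - k * π := by push_cast; ring
      rw [this, cos_sub_nat_mul_pi, abs_mul, abs_pow]; simp
    have e2 : hh (2 * k) y = cosh y := by
      rw [hh, cosh_eq, pow_mul]; simp
    have e3 : ∀ ν : ℕ, (-1 : ℝ) ^ (ν * (2 * k + 1)) = (-1) ^ ν := fun ν => by
      rw [mul_comm, pow_mul, pow_succ, pow_mul]; simp
    simp only [e1, e2, e3]
    rw [int_abs_cos hy]
    exact hasSum_arctan_exp hy
  · have e1 : ∀ u, |cos (u - (2 * k + 1 : ℕ) * (π / 2))| = |sin u| := fun u => by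
      have : u - (2 * k + 1 : ℕ) * (π / 2) = (u - π / 2) - k * π := by push_cast; ring
      rw [this, cos_sub_nat_mul_pi, abs_mul, abs_pow, cos_sub_pi_div_two]; simp
    have e2 : hh (2 * k + 1) y = sinh y := by
      rw [hh, sinh_eq, pow_succ, pow_mul]; simp; ring
    have e3 : ∀ ν : ℕ, (-1 : ℝ) ^ (ν * (2 * k + 1 + 1)) = 1 := fun ν => by
      have : ν * (2 * k + 1 + 1) = 2 * (ν * (k + 1)) := by ring
      rw [this, pow_mul]; simp
    simp only [e1, e2, e3, one_mul]
    rw [int_abs_sin hy]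
    exact hasSum_log_exp hy

open MeasureTheory in
theorem int_of_hasSum {μ : Measure ℝ} {F : ℕ → ℝ → ℝ} {S : ℝ → ℝ}
    (hF : ∀ i, Integrable (F i) μ) (hs : Summable fun i => ∫ a, ‖F i a‖ ∂μ)
    (hS : ∀ᵐ x ∂μ, HasSum (fun i => F i x) (S x)) :
    Integrable S μ ∧ HasSum (fun i => ∫ a, F i a ∂μ) (∫ a, S a ∂μ) := by
  constructor
  · constructor
    · refine aestronglyMeasurable_of_tendsto_ae Filter.atTop
        (f := fun n x => ∑ i ∈ Finset.range n, F i x) (fun n => ?_) ?_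
      · exact (integrable_finsetSum _ fun i _ => hF i).1
      · filter_upwards [hS] with x hx using hx.tendsto_sum_nat
    · have h1 : ∫⁻ a, ‖S a‖ₑ ∂μ ≤ ∫⁻ a, ∑' i, ‖F i a‖ₑ ∂μ := by
        refine lintegral_mono_ae ?_
        filter_upwards [hS] with x hx
        rw [← hx.tsum_eq]
        exact enorm_tsum_le_tsum_enorm
      refine lt_of_le_of_lt h1 ?_
      rw [lintegral_tsum (fun i => (hF i).1.enorm)]
      have (i : ℕ) : ∫⁻ a, ‖F i a‖ₑ ∂μ = ENNReal.ofReal (∫ a, ‖F i a‖ ∂μ) :=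
        (ofReal_integral_norm_eq_lintegral_enorm (hF i)).symm
      rw [funext this]
      exact hs.tsum_ofReal_lt_top
  · have := hasSum_integral_of_summable_integral_norm hF hs
    rwa [integral_congr_ae (g := S) ?_] at this
    filter_upwards [hS] with x hx using hx.tsum_eq

theorem Ef_bound {r N : ℕ} (hN : 1 ≤ N) {ψ : ℝ → ℝ} (hc : Continuous ψ) (hψ : ∀ t, |ψ t| ≤ 1) (t : ℝ) {x : ℝ}
    (hx : 0 < x) : |Ef r N ψ t x| ≤
      (∫ u in (-π)..π, |cos (u - r * (π / 2))| * Pk (N * x) u) / (2 * π * hh r (N * x)) := by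
  have hN' : (0 : ℝ) < N := by exact_mod_cast hN
  have hh := hh_pos r (y := N * x) (by positivity)
  have hπ := pi_pos
  have hcp := Pk_cont hx
  rw [← Pk_scale hx hN, Ef, abs_div, abs_of_pos (a := 2 * π * _) (by positivity)]
  gcongr
  rw [← Real.norm_eq_abs]
  refine intervalIntegral.norm_integral_le_of_norm_le (by linarith) (Filter.Eventually.of_forall fun u _ => ?_)
    (Continuous.intervalIntegrable (by fun_prop) _ _)
  rw [Real.norm_eq_abs, abs_mul, abs_mul, abs_of_nonneg (Pk_nonneg hx u)]
  have := mul_le_mul_of_nonneg_right (hψ (t - u))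
    (mul_nonneg (abs_nonneg (cos (N * u - r * (π / 2)))) (Pk_nonneg hx u))
  linarith

theorem favard_lemma (m : ℕ) {N K : ℕ} (hN : 1 ≤ N) {ψ : ℝ → ℝ} (hψT : ψ ∈ Tr K) (hψ : ∀ t, |ψ t| ≤ 1) :
    ∃ F ∈ Tr K, ∃ c : ℝ, ∃ τ ∈ Tr (N - 1), (∀ t, iteratedDeriv (m + 1) F t = ψ t - c) ∧
      ∀ t, |F t - τ t| ≤ favardK (m + 1) / N ^ (m + 1) := by
  obtain ⟨F, hF, c, τ, hτ, h1, h2, h3⟩ := FP_all m N K hN hψT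
  refine ⟨F, hF, c, τ, hτ, h1, fun t => ?_⟩
  have hN' : (0 : ℝ) < N := by exact_mod_cast hN
  have hπ := pi_pos
  set c' : ℕ → ℝ := fun ν => (4 / π) * ((-1) ^ (ν * (m + 1 + 1)) / (2 * ν + 1)) with hc'
  set G : ℕ → ℝ → ℝ := fun ν x => c' ν * (x ^ m / m.factorial * exp (-((2 * ν + 1) * N * x))) with hG
  set S : ℝ → ℝ := fun x => x ^ m / m.factorial *
    ((∫ u in (-π)..π, |cos (u - (m + 1 : ℕ) * (π / 2))| * Pk (N * x) u) / (2 * π * hh (m + 1) (N * x))) with hS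
  have ha : ∀ ν : ℕ, (0 : ℝ) < (2 * ν + 1) * N := fun ν => by positivity
  have hGi : ∀ ν, MeasureTheory.IntegrableOn (G ν) (Set.Ioi 0) := fun ν =>
    (gamma_int m (ha ν)).1.const_mul _
  have hGe : ∀ ν, ∫ x in Set.Ioi (0:ℝ), G ν x = c' ν * (1 / ((2 * ν + 1) * N) ^ (m + 1)) := fun ν => by
    simp only [hG]
    rw [MeasureTheory.integral_const_mul, (gamma_int m (ha ν)).2]
  have hc'a : ∀ ν, |c' ν| = (4 / π) * (1 / (2 * ν + 1)) := fun ν => by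
    simp only [hc']
    rw [abs_mul, abs_of_pos (by positivity : 0 < 4 / π), abs_div, abs_pow, abs_neg, abs_one, one_pow,
      abs_of_pos (by positivity : (0:ℝ) < 2 * ν + 1)]
  have hGn : ∀ ν, ∫ x in Set.Ioi (0:ℝ), ‖G ν x‖ = (4 / π) * (1 / (2 * ν + 1)) * (1 / ((2 * ν + 1) * N) ^ (m + 1)) := fun ν => by
    rw [← (gamma_int m (ha ν)).2, ← hc'a, ← MeasureTheory.integral_const_mul]
    refine MeasureTheory.setIntegral_congr_fun measurableSet_Ioi fun x hx => ?_
    have hx : 0 < x := hx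
    simp only [hG]
    rw [Real.norm_eq_abs, abs_mul, abs_of_nonneg (a := x ^ m / _ * _) (by positivity)]
  have hsum : Summable fun ν => ∫ x in Set.Ioi (0:ℝ), ‖G ν x‖ := by
    simp only [hGn]
    have hz : Summable fun n : ℕ => 1 / ((n + 1 : ℕ) : ℝ) ^ 2 :=
      (summable_nat_add_iff 1).2 (Real.summable_one_div_nat_pow.2 (by norm_num))
    refine Summable.of_nonneg_of_le (fun ν => by positivity) (fun ν => ?_) (hz.mul_left (4 / π))
    rw [mul_assoc]
    refine mul_le_mul_of_nonneg_left ?_ (by positivity)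
    rw [one_div_mul_one_div]
    refine one_div_le_one_div_of_le (by positivity) ?_
    have hN1 : (1 : ℝ) ≤ N := by exact_mod_cast hN
    have h5 : (ν : ℝ) + 1 ≤ 2 * ν + 1 := by linarith [(Nat.cast_nonneg ν : (0:ℝ) ≤ ν)]
    have h6 : (2 * ν + 1 : ℝ) ≤ (2 * ν + 1) * N := le_mul_of_one_le_right (by positivity) hN1
    have h7 : (2 * ν + 1 : ℝ) * N ≤ ((2 * ν + 1) * N) ^ (m + 1) :=
      le_self_pow₀ (by nlinarith [(Nat.cast_nonneg ν : (0:ℝ) ≤ ν)]) (by omega)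
    push_cast
    rw [sq]
    refine mul_le_mul h5 (by linarith) (by positivity) (by positivity)
  have hHS : ∀ x ∈ Set.Ioi (0:ℝ), HasSum (fun ν => G ν x) (S x) := fun x hx => by
    have hx : 0 < x := hx
    have := (hasSum_L1 (m + 1) (y := N * x) (by positivity)).mul_left (x ^ m / m.factorial)
    simp only [hG, hS]
    refine this.congr_fun fun ν => ?_
    have : exp (-((2 * ν + 1) * N * x)) = exp (-(N * x)) ^ (2 * ν + 1) := by
      rw [← exp_nat_mul]; congr 1; push_cast; ring
    rw [this, hc']; ring
  have key := int_of_hasSum hGi hsum (MeasureTheory.ae_restrict_of_forall_mem measurableSet_Ioi hHS)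
  have hfin : ∫ x in Set.Ioi (0:ℝ), S x = favardK (m + 1) / N ^ (m + 1) := by
    rw [← key.2.tsum_eq, favardK, ← tsum_mul_left, ← tsum_div_const]
    refine tsum_congr fun ν => ?_
    rw [hGe]; simp only [hc']
    have : (0 : ℝ) < 2 * ν + 1 := by positivity
    rw [mul_pow]; field_simp; ring
  rw [h3 t, ← hfin, ← Real.norm_eq_abs]
  refine MeasureTheory.norm_integral_le_of_norm_le key.1
    (MeasureTheory.ae_restrict_of_forall_mem measurableSet_Ioi fun x hx => ?_)
  have hx : 0 < x := hx
  rw [Real.norm_eq_abs, abs_mul, abs_of_nonneg (a := x ^ m / _) (by positivity)]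
  exact mul_le_mul_of_nonneg_left (Ef_bound hN (Tr_cont hψT) hψ t hx) (by positivity)

end Trigub

namespace Trigub

theorem App_mono {n D D' : ℕ} {C C' : ℝ} {W g : ℝ → ℝ} (h : App n D C W g) (hD : D ≤ D') (hW : ∀ t, 0 ≤ W t)
    (hC : C ≤ C') : App n D' C' W g := by
  obtain ⟨T, hT, hb⟩ := h
  exact ⟨T, Tr_mono (Nat.mul_le_mul_right _ hD) hT, fun t => (hb t).trans (mul_le_mul_of_nonneg_right hC (hW t))⟩

theorem Z_neg_sin_pow (r : ℕ) : Z r (fun t => (-sin t) ^ r) :=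
  ⟨0, fun _ => (-1) ^ r, Tr_const 0 _, fun t => by
    beta_reduce; rw [neg_pow, mul_comm]⟩

theorem leib {d K r : ℕ} {a F : ℝ → ℝ} (ha : a ∈ Tr d) (hF : F ∈ Tr K) (t : ℝ) :
    iteratedDeriv r (fun t => a t * F t) t = ∑ i ∈ Finset.range (r + 1),
      r.choose i * iteratedDeriv i a t * iteratedDeriv (r - i) F t :=
  iteratedDeriv_mul ((Tr_contDiff ha).contDiffAt.of_le (by exact le_top))
    ((Tr_contDiff hF).contDiffAt.of_le (by exact le_top))

theorem rem_lemma (m : ℕ) : ∃ C : ℝ, 0 ≤ C ∧ ∃ D : ℕ, ∀ f : Polynomial ℝ,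
    (∀ x ∈ Set.Icc (-1 : ℝ) 1, |(Polynomial.derivative^[m + 1] f).eval x| ≤ 1) → ∀ n : ℕ, 1 ≤ n →
    ∀ K, ∀ F ∈ Tr K, ∀ c : ℝ,
      (∀ t, iteratedDeriv (m + 1) F t = (Polynomial.derivative^[m + 1] f).eval (cos t) - c) →
      ∃ T ∈ Tr (D * n), ∀ i ≤ m, ∀ t,
        |iteratedDeriv i (fun t => f.eval (cos t) - (-sin t) ^ (m + 1) * F t - T t) t| ≤
          C * n ^ i / n ^ (m + 2) * sw n t ^ m := by
  set r := m + 1 with hr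
  set a : ℝ → ℝ := fun t => (-sin t) ^ r with ha
  have haZ : Z r a := Z_neg_sin_pow r
  obtain ⟨da, hda⟩ := Z_mem haZ
  choose C0 hC0 D0 h0 using S_lemma
  have hA : ∀ k : ℕ, ∃ A : ℝ, 0 ≤ A ∧ (k < r → ∀ n : ℕ, 1 ≤ n → ∀ t,
      |fa r k t| * (sw n t ^ (r - k) / n ^ (r - k)) ≤ A * (sw n t ^ (r - 1) / n ^ 1)) := fun k => by
    by_cases hk : k < r
    · obtain ⟨A, hA, h⟩ := sw_term r k 1 hk.le (by omega)
      exact ⟨A, hA, fun _ => h⟩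
    · exact ⟨0, le_rfl, fun h => absurd h hk⟩
  choose A hA0 hA using hA
  choose d hd using fun k => Z_mem (fa_Z r k)
  choose B hB0 hB using fun i => Z_bound (Z_iter haZ i)
  obtain ⟨C2, hC2, D2, h2⟩ := multistep 0 r
  obtain ⟨C1, hC1, D1, h1⟩ := multistep m r
  set M := ∑ k ∈ Finset.range m, C0 (r - (k + 1)) * A (k + 1) +
    (0 + ∑ i ∈ Finset.range r, C2 * (r.choose (i + 1) * B (i + 1))) with hM
  have hM0 : 0 ≤ M := by
    refine add_nonneg (Finset.sum_nonneg fun k hk => mul_nonneg (hC0 _) (hA0 _)) ?_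
    rw [zero_add]
    exact Finset.sum_nonneg fun i hi => mul_nonneg hC2 (mul_nonneg (Nat.cast_nonneg _) (hB0 _))
  set DD := ∑ k ∈ Finset.range m, (D0 (r - (k + 1)) + d (k + 1)) +
    (da + ∑ i ∈ Finset.range r, (D2 + da)) with hDD
  refine ⟨C1 * M, by positivity, max DD D1, fun f hf n hn K F hF c hFc => ?_⟩
  have hn' : (0 : ℝ) < n := by exact_mod_cast hn
  have happ1 : App n (∑ k ∈ Finset.range m, (D0 (r - (k + 1)) + d (k + 1)))
      (∑ k ∈ Finset.range m, C0 (r - (k + 1)) * A (k + 1)) (fun t => sw n t ^ m / n)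
      (fun t => ∑ k ∈ Finset.range m,
        (Polynomial.derivative^[k + 1] f).eval (cos t) * fa r (k + 1) t) := by
    refine App_sum _ fun k hk => ?_
    have hk' := Finset.mem_range.1 hk
    refine App_mul hn (hC0 _) (h0 (r - (k + 1)) _ ?_ n hn) (hd (k + 1)) ?_
    · intro x hx
      rw [← Function.iterate_add_apply, show r - (k + 1) + (k + 1) = r by omega]
      exact hf x hx
    · intro t
      simpa [hr] using hA (k + 1) (by omega) n hn t
  have happ2 : App n da 0 (fun t => sw n t ^ m / n) (fun t => c * a t) :=
    ⟨fun t => c * a t, Tr_mono (Nat.le_mul_of_pos_right _ hn) (Tr_smul c hda), fun t => by simp⟩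
  have happ3 : App n (∑ i ∈ Finset.range r, (D2 + da))
      (∑ i ∈ Finset.range r, C2 * (r.choose (i + 1) * B (i + 1))) (fun t => sw n t ^ m / n)
      (fun t => ∑ i ∈ Finset.range r,
        iteratedDeriv (r - (i + 1)) F t * (-(r.choose (i + 1)) * iteratedDeriv (i + 1) a t)) := by
    obtain ⟨TF, hTF, hTb⟩ := h2 n hn 0 K 1 zero_le_one F hF (fun _ => -c) (Tr_const 0 _) (fun t => by
      rw [hFc t]
      simpa using hf (cos t) ⟨neg_one_le_cos t, cos_le_one t⟩)
    refine App_sum _ fun i hi => ?_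
    have hi' := Finset.mem_range.1 hi
    refine App_mul (W := fun _ => (n : ℝ) ^ (r - (i + 1)) / n ^ r) hn hC2
      ⟨iteratedDeriv (r - (i + 1)) TF, Tr_iter (by simpa using hTF) _, fun t => ?_⟩
      (Tr_smul _ (Tr_iter hda _)) ?_
    · rw [← iter_sub hF hTF]
      refine (hTb (r - (i + 1)) (by omega) t).trans (le_of_eq ?_)
      rw [pow_zero]; ring
    · intro t
      rw [abs_mul, abs_neg, Nat.abs_cast, mul_assoc, mul_assoc]
      refine mul_le_mul_of_nonneg_left ?_ (Nat.cast_nonneg _)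
      have e1 : (n : ℝ) ^ (r - (i + 1)) / n ^ r = (1 / n) ^ i * (1 / n) := by
        have : (n : ℝ) ^ r = n ^ (r - (i + 1)) * (n ^ i * n) := by
          rw [← pow_succ, ← pow_add]; congr 1; omega
        rw [this, one_div_pow]; field_simp
      rw [e1]
      have h5 : |sin t| ^ (r - (i + 1)) * (1 / (n : ℝ)) ^ i ≤ sw n t ^ m := by
        have : m = (r - (i + 1)) + i := by omega
        rw [this, pow_add]
        gcongr
        · exact pow_nonneg (sw_nonneg n t) _
        · exact sin_le_sw n t
        · exact inv_le_sw n t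
      calc |iteratedDeriv (i + 1) a t| * ((1 / (n:ℝ)) ^ i * (1 / n))
          ≤ (B (i + 1) * |sin t| ^ (r - (i + 1))) * ((1 / (n:ℝ)) ^ i * (1 / n)) :=
            mul_le_mul_of_nonneg_right (hB _ t) (by positivity)
        _ = B (i + 1) * ((|sin t| ^ (r - (i + 1)) * (1 / (n : ℝ)) ^ i) * (1 / n)) := by ring
        _ ≤ B (i + 1) * (sw n t ^ m * (1 / n)) :=
            mul_le_mul_of_nonneg_left (mul_le_mul_of_nonneg_right h5 (by positivity)) (hB0 _)
        _ = _ := by ring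
  have happ := App_add happ1 (App_add happ2 happ3)
  rw [← hM, ← hDD] at happ
  obtain ⟨τ, hτ, hb⟩ := happ
  have hfT := Tr_poly f le_rfl
  have haF := Tr_mul hda hF
  have h3 : ∀ t, iteratedDeriv r (fun t => f.eval (cos t) - a t * F t) t =
      ∑ k ∈ Finset.range m, (Polynomial.derivative^[k + 1] f).eval (cos t) * fa r (k + 1) t +
      (c * a t + ∑ i ∈ Finset.range r,
        iteratedDeriv (r - (i + 1)) F t * (-(r.choose (i + 1)) * iteratedDeriv (i + 1) a t)) := fun t => by
    rw [iter_sub hfT haF, fa_formula, leib hda hF, Finset.sum_range_succ, Finset.sum_range_succ' _ m,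
      Finset.sum_range_succ' _ r, fa_self, hr, fa_zero, Nat.sub_zero, hFc t, ← hr]
    have : ∑ i ∈ Finset.range r, (r.choose (i + 1) : ℝ) * iteratedDeriv (i + 1) a t *
        iteratedDeriv (r - (i + 1)) F t = -∑ i ∈ Finset.range r,
        iteratedDeriv (r - (i + 1)) F t * (-(r.choose (i + 1)) * iteratedDeriv (i + 1) a t) := by
      rw [← Finset.sum_neg_distrib]
      exact Finset.sum_congr rfl fun i _ => by ring
    rw [this]
    simp only [Nat.choose_zero_right, Nat.cast_one, iteratedDeriv_zero]
    simp only [ha]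
    ring
  have hRT : (fun t => f.eval (cos t) - a t * F t) ∈ Tr (max f.natDegree (da + K)) :=
    Tr_sub (Tr_mono (le_max_left _ _) hfT) (Tr_mono (le_max_right _ _) haF)
  obtain ⟨T, hT, hb'⟩ := h1 n hn _ _ (M / n) (by positivity) _ hRT τ hτ (fun t => by
    rw [h3]; refine (hb t).trans (le_of_eq ?_); ring)
  refine ⟨T, Tr_mono ?_ hT, fun i hi t => ?_⟩
  · rw [max_mul_of_nonneg _ _ (Nat.zero_le _)]
  · refine (hb' i (by omega) t).trans (le_of_eq ?_)
    rw [pow_succ (n : ℝ) (m + 1), ← hr]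
    field_simp

end Trigub

namespace Trigub

theorem favardK_nonneg (m : ℕ) : 0 ≤ favardK (m + 1) := by
  obtain ⟨F, _, c, τ, _, _, h⟩ := favard_lemma m (N := 1) (K := 0) le_rfl (Tr_const 0 0) (fun t => by simp)
  have := (abs_nonneg _).trans (h 0)
  simpa using this

theorem one_add_pow_le {u : ℝ} (h0 : 0 ≤ u) (h1 : u ≤ 1) (r : ℕ) : (1 + u) ^ r ≤ 1 + (2 ^ r - 1) * u := by
  induction r with
  | zero => simp
  | succ r ih =>
    have h2 : (1 : ℝ) ≤ 2 ^ r := one_le_pow₀ (by norm_num)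
    have : (1 + u) ^ (r + 1) ≤ (1 + (2 ^ r - 1) * u) * (1 + u) := by
      rw [pow_succ]; exact mul_le_mul_of_nonneg_right ih (by linarith)
    refine this.trans ?_
    have h3 : (2 ^ r - 1) * u * u ≤ (2 ^ r - 1) * u * 1 :=
      mul_le_mul_of_nonneg_left h1 (mul_nonneg (by linarith) h0)
    rw [pow_succ]; nlinarith

theorem inv_pow_shift (r : ℕ) {N : ℝ} (hN : 2 * r + 1 ≤ N) :
    1 / (N - r) ^ r ≤ 1 / N ^ r + (2 ^ r * (2 * r)) / N ^ (r + 1) := by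
  have hr0 : (0 : ℝ) ≤ r := Nat.cast_nonneg r
  have hN0 : 0 < N := by linarith
  have hNr : 0 < N - r := by linarith
  set u : ℝ := r / (N - r) with hu
  have hu0 : 0 ≤ u := by positivity
  have hu1 : u ≤ 1 := by rw [hu, div_le_one hNr]; linarith
  have hu2 : u ≤ 2 * r / N := by
    rw [hu, div_le_div_iff₀ hNr hN0]; nlinarith
  have h := one_add_pow_le hu0 hu1 r
  have e : (1 + u) = N / (N - r) := by rw [hu]; field_simp; ring
  have h2 : (1 : ℝ) ≤ 2 ^ r := one_le_pow₀ (by norm_num)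
  have h3 : (N / (N - r)) ^ r ≤ 1 + 2 ^ r * (2 * r / N) := by
    rw [← e]
    refine h.trans ?_
    have : (2 ^ r - 1) * u ≤ 2 ^ r * (2 * r / N) := by
      refine mul_le_mul (by linarith) hu2 hu0 (by positivity)
    linarith
  calc 1 / (N - r) ^ r = (N / (N - r)) ^ r * (1 / N ^ r) := by rw [div_pow]; field_simp
    _ ≤ (1 + 2 ^ r * (2 * r / N)) * (1 / N ^ r) := mul_le_mul_of_nonneg_right h3 (by positivity)
    _ = _ := by rw [pow_succ]; field_simp

theorem poly_large (m : ℕ) : ∃ C : ℝ, 0 ≤ C ∧ ∃ n0 : ℕ, ∀ f : Polynomial ℝ,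
    (∀ x ∈ Set.Icc (-1 : ℝ) 1, |(Polynomial.derivative^[m + 1] f).eval x| ≤ 1) → ∀ n : ℕ, n0 ≤ n →
    ∃ T ∈ Tr n, ∀ t, |f.eval (cos t) - T t| ≤
      favardK (m + 1) * (|sin t| / (n + 1)) ^ (m + 1) + C * |sin t| ^ m / (n + 1) ^ (m + 2) := by
  obtain ⟨C1, hC1, D, h1⟩ := rem_lemma m
  obtain ⟨C2, hC2, h2⟩ := correction m
  have hK := favardK_nonneg m
  refine ⟨favardK (m + 1) * (2 ^ (m + 1) * (2 * (m + 1 : ℕ))) + C2 * C1 * (2 * (D + 1)) ^ (m + 2), by positivity,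
    max (D + 1) (2 * (m + 1)), fun f hf n hn => ?_⟩
  have hnD : D + 1 ≤ n := (le_max_left _ _).trans hn
  have hnm : 2 * (m + 1) ≤ n := (le_max_right _ _).trans hn
  obtain ⟨F, hF, c, τ, hτ, hFc, hFb⟩ := favard_lemma m (N := n + 1 - (m + 1)) (by omega)
    (Tr_poly (Polynomial.derivative^[m + 1] f) le_rfl)
    (fun t => hf (cos t) ⟨neg_one_le_cos t, cos_le_one t⟩)
  set k := n / (D + 1) with hk
  have hk1 : 1 ≤ k := (Nat.one_le_div_iff (by omega)).2 hnD
  have hk2 : (D + 1) * k ≤ n := Nat.mul_div_le n (D + 1)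
  have hk3 : n + 1 ≤ 2 * (D + 1) * k := by
    have : n < (D + 1) * (k + 1) := Nat.lt_mul_div_succ n (by omega)
    nlinarith
  have hk0 : (0 : ℝ) < k := by exact_mod_cast hk1
  obtain ⟨T, hT, hTb⟩ := h1 f hf k hk1 _ F hF c hFc
  have hsp : (fun t => (-sin t) ^ (m + 1)) ∈ Tr ((m + 1) * 1) := by
    refine Tr_pow ?_ _
    simpa using Tr_smul (-1) Tr_sin1
  have hfT := Tr_poly f le_rfl
  have haF := Tr_mul hsp hF
  have hTn : T ∈ Tr n := Tr_mono (by nlinarith) hT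
  obtain ⟨K, hK1, hK2, hK3⟩ : ∃ K, f.natDegree ≤ K ∧
      (m + 1) * 1 + (Polynomial.derivative^[m + 1] f).natDegree ≤ K ∧ n ≤ K :=
    ⟨f.natDegree + ((m + 1) * 1 + (Polynomial.derivative^[m + 1] f).natDegree) + n, by omega, by omega, by omega⟩
  obtain ⟨q, hq, hqb⟩ := h2 k hk1 K (C1 / k ^ (m + 2)) (by positivity) _
    (Tr_sub (Tr_sub (Tr_mono hK1 hfT) (Tr_mono hK2 haF)) (Tr_mono hK3 hTn)) (fun i hi t =>
      (hTb i hi t).trans (le_of_eq (by ring)))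
  refine ⟨fun t => (-sin t) ^ (m + 1) * τ t + (T t + q t), Tr_add (Tr_mono ?_ (Tr_mul hsp hτ))
    (Tr_add hTn (Tr_mono (by omega) hq)), fun t => ?_⟩
  · omega
  have e1 : f.eval (cos t) - ((-sin t) ^ (m + 1) * τ t + (T t + q t)) =
      (-sin t) ^ (m + 1) * (F t - τ t) + (f.eval (cos t) - (-sin t) ^ (m + 1) * F t - T t - q t) := by ring
  rw [e1]
  have hs0 := abs_nonneg (sin t)
  have hs1 := abs_sin_le_one t
  have hn1 : (0 : ℝ) < (n : ℝ) + 1 := by positivity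
  have hsm : |sin t| ^ (m + 1) ≤ |sin t| ^ m := pow_le_pow_of_le_one hs0 hs1 (by omega)
  have b1 : |(-sin t) ^ (m + 1) * (F t - τ t)| ≤ favardK (m + 1) * (|sin t| / (n + 1)) ^ (m + 1) +
      favardK (m + 1) * (2 ^ (m + 1) * (2 * (m + 1 : ℕ))) * |sin t| ^ m / (n + 1) ^ (m + 2) := by
    rw [abs_mul, abs_pow, abs_neg]
    have hsh := inv_pow_shift (m + 1) (N := (n : ℝ) + 1) (by exact_mod_cast (by omega))
    have hcast : ((n + 1 - (m + 1) : ℕ) : ℝ) = (n : ℝ) + 1 - ((m + 1 : ℕ) : ℝ) := by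
      rw [Nat.cast_sub (by omega)]; push_cast; ring
    have hb := hFb t
    rw [hcast] at hb
    calc |sin t| ^ (m + 1) * |F t - τ t|
        ≤ |sin t| ^ (m + 1) * (favardK (m + 1) / ((n : ℝ) + 1 - ((m + 1 : ℕ) : ℝ)) ^ (m + 1)) :=
          mul_le_mul_of_nonneg_left hb (by positivity)
      _ = |sin t| ^ (m + 1) * favardK (m + 1) * (1 / ((n : ℝ) + 1 - ((m + 1 : ℕ) : ℝ)) ^ (m + 1)) := by ring
      _ ≤ |sin t| ^ (m + 1) * favardK (m + 1) * (1 / ((n : ℝ) + 1) ^ (m + 1) +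
            (2 ^ (m + 1) * (2 * (m + 1 : ℕ))) / ((n : ℝ) + 1) ^ (m + 1 + 1)) :=
          mul_le_mul_of_nonneg_left hsh (by positivity)
      _ = favardK (m + 1) * (|sin t| / (n + 1)) ^ (m + 1) + favardK (m + 1) *
            (2 ^ (m + 1) * (2 * (m + 1 : ℕ))) / (n + 1) ^ (m + 2) * |sin t| ^ (m + 1) := by
          rw [div_pow]; ring
      _ ≤ favardK (m + 1) * (|sin t| / (n + 1)) ^ (m + 1) + favardK (m + 1) *
            (2 ^ (m + 1) * (2 * (m + 1 : ℕ))) / (n + 1) ^ (m + 2) * |sin t| ^ m := by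
          have := mul_le_mul_of_nonneg_left hsm (a := favardK (m + 1) *
            (2 ^ (m + 1) * (2 * (m + 1 : ℕ))) / ((n : ℝ) + 1) ^ (m + 2)) (by positivity)
          linarith
      _ = _ := by ring
  have b2 : |f.eval (cos t) - (-sin t) ^ (m + 1) * F t - T t - q t| ≤
      C2 * C1 * (2 * (D + 1)) ^ (m + 2) * |sin t| ^ m / (n + 1) ^ (m + 2) := by
    refine (hqb t).trans ?_
    have h3 : ((n : ℝ) + 1) ^ (m + 2) ≤ (2 * (D + 1) * k) ^ (m + 2) := by
      gcongr; exact_mod_cast hk3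
    have h4 : 1 / (k : ℝ) ^ (m + 2) ≤ (2 * (D + 1)) ^ (m + 2) / (n + 1) ^ (m + 2) := by
      rw [div_le_div_iff₀ (by positivity) (by positivity), ← mul_pow, one_mul]; exact h3
    calc C2 * (C1 / k ^ (m + 2)) * |sin t| ^ m = C2 * C1 * |sin t| ^ m * (1 / (k : ℝ) ^ (m + 2)) := by ring
      _ ≤ C2 * C1 * |sin t| ^ m * ((2 * (D + 1)) ^ (m + 2) / (n + 1) ^ (m + 2)) :=
        mul_le_mul_of_nonneg_left h4 (by positivity)
      _ = _ := by ring
  refine (abs_add_le _ _).trans ((add_le_add b1 b2).trans (le_of_eq ?_))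
  ring

theorem taylor_sub (f : Polynomial ℝ) (r : ℕ) : ∃ P : Polynomial ℝ, P.natDegree ≤ r - 1 ∧
    Polynomial.derivative^[r] P = 0 ∧ ∀ k < r, (Polynomial.derivative^[k] (f - P)).eval 0 = 0 := by
  have hm : (Polynomial.X ^ r : Polynomial ℝ).Monic := Polynomial.monic_X_pow r
  have hd := Polynomial.degree_modByMonic_lt f hm
  rw [Polynomial.degree_X_pow] at hd
  have e := Polynomial.modByMonic_add_div f (Polynomial.X ^ r : Polynomial ℝ)
  refine ⟨f %ₘ (Polynomial.X ^ r), ?_, ?_, fun k hk => ?_⟩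
  · rcases Nat.eq_zero_or_pos r with rfl | hr
    · simp
    · by_cases h0 : f %ₘ (Polynomial.X ^ r) = 0
      · simp [h0]
      · have := (Polynomial.natDegree_lt_iff_degree_lt h0).2 hd
        omega
  · by_cases h0 : f %ₘ (Polynomial.X ^ r) = 0
    · simp [h0]
    · exact Polynomial.iterate_derivative_eq_zero ((Polynomial.natDegree_lt_iff_degree_lt h0).2 hd)
  · have e2 : f - f %ₘ (Polynomial.X ^ r) = Polynomial.X ^ r * (f /ₘ Polynomial.X ^ r) := by
      linear_combination (-1 : Polynomial ℝ) * e
    rw [e2, ← Polynomial.coeff_zero_eq_eval_zero, Polynomial.coeff_iterate_derivative, zero_add,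
      Polynomial.coeff_X_pow_mul', if_neg (by omega)]
    simp

theorem poly_mvt (h : Polynomial ℝ) (h0 : h.eval 0 = 0)
    (h1 : ∀ x ∈ Set.Icc (-1 : ℝ) 1, |(Polynomial.derivative h).eval x| ≤ 1) :
    ∀ x ∈ Set.Icc (-1 : ℝ) 1, |h.eval x| ≤ 1 := by
  intro x hx
  have := Convex.norm_image_sub_le_of_norm_hasDerivWithin_le (f := fun x => h.eval x)
    (f' := fun x => (Polynomial.derivative h).eval x) (C := 1) (s := Set.Icc (-1 : ℝ) 1)
    (fun x _ => (h.hasDerivAt x).hasDerivWithinAt) (fun x hx => h1 x hx) (convex_Icc _ _)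
    (x := 0) (y := x) (by constructor <;> norm_num) hx
  simp only [h0, sub_zero, one_mul, Real.norm_eq_abs] at this
  exact this.trans (abs_le.2 hx)

theorem taylor_bounds (h : Polynomial ℝ) (r : ℕ) (h0 : ∀ k < r, (Polynomial.derivative^[k] h).eval 0 = 0)
    (h1 : ∀ x ∈ Set.Icc (-1 : ℝ) 1, |(Polynomial.derivative^[r] h).eval x| ≤ 1) :
    ∀ j ≤ r, ∀ x ∈ Set.Icc (-1 : ℝ) 1, |(Polynomial.derivative^[r - j] h).eval x| ≤ 1 := by
  intro j
  induction j with
  | zero => intro _; simpa using h1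
  | succ j ih =>
    intro hj
    refine poly_mvt _ (h0 _ (by omega)) ?_
    rw [← Function.iterate_succ_apply' (⇑Polynomial.derivative), show (r - (j + 1)).succ = r - j by omega]
    exact ih (by omega)

theorem poly_small (m : ℕ) : ∃ C : ℝ, 0 ≤ C ∧ ∀ f : Polynomial ℝ,
    (∀ x ∈ Set.Icc (-1 : ℝ) 1, |(Polynomial.derivative^[m + 1] f).eval x| ≤ 1) →
    ∃ T ∈ Tr m, ∀ t, |f.eval (cos t) - T t| ≤ C * |sin t| ^ m := by
  obtain ⟨C2, hC2, h2⟩ := correction m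
  have : ∀ i k, ∃ B : ℝ, 0 ≤ B ∧ ∀ t, |fa i k t| ≤ B := fun i k =>
    Tr_bounded (Z_mem (fa_Z i k)).choose_spec
  choose B hB0 hB using this
  set M := ∑ i ∈ Finset.range (m + 1), ∑ k ∈ Finset.range (i + 1), B i k with hM
  have hM0 : 0 ≤ M := Finset.sum_nonneg fun i _ => Finset.sum_nonneg fun k _ => hB0 i k
  refine ⟨C2 * M, by positivity, fun f hf => ?_⟩
  obtain ⟨P, hP, hPr, hP0⟩ := taylor_sub f (m + 1)
  have hb := taylor_bounds (f - P) (m + 1) hP0 (by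
    intro x hx; rw [Polynomial.iterate_derivative_sub, hPr, sub_zero]; exact hf x hx)
  obtain ⟨q, hq, hqb⟩ := h2 1 le_rfl _ M hM0 _ (Tr_poly (f - P) le_rfl) (fun i hi t => by
    rw [fa_formula]
    have b1 : |∑ k ∈ Finset.range (i + 1), (Polynomial.derivative^[k] (f - P)).eval (cos t) * fa i k t| ≤ M := by
      refine (Finset.abs_sum_le_sum_abs _ _).trans ?_
      refine (Finset.sum_le_sum (g := fun k => B i k) fun k hk => ?_).trans
        (Finset.single_le_sum (f := fun i => ∑ k ∈ Finset.range (i + 1), B i k)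
          (fun i _ => Finset.sum_nonneg fun k _ => hB0 i k) (Finset.mem_range.2 (by omega)))
      have hk' := Finset.mem_range.1 hk
      have := hb (m + 1 - k) (by omega) (cos t) ⟨neg_one_le_cos t, cos_le_one t⟩
      rw [show m + 1 - (m + 1 - k) = k by omega] at this
      rw [abs_mul]
      calc _ ≤ 1 * B i k := mul_le_mul this (hB i k t) (abs_nonneg _) zero_le_one
        _ = _ := one_mul _
    have b2 : (1 : ℝ) ≤ sw 1 t ^ m := one_le_pow₀ (by
      have := inv_le_sw 1 t
      simpa using this)
    simp only [Nat.cast_one, one_pow, mul_one]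
    refine b1.trans (le_mul_of_one_le_right hM0 b2))
  refine ⟨fun t => P.eval (cos t) + q t, Tr_add (Tr_poly P (by simpa using hP)) hq, fun t => ?_⟩
  have := hqb t
  simp only [Polynomial.eval_sub] at this
  rwa [sub_sub] at this

theorem to_poly {n : ℕ} {f : Polynomial ℝ} {T : ℝ → ℝ} (hT : T ∈ Tr n) {B : ℝ → ℝ}
    (h : ∀ t, |f.eval (cos t) - T t| ≤ B |sin t|) :
    ∃ p : Polynomial ℝ, p.natDegree ≤ n ∧ ∀ x ∈ Set.Icc (-1 : ℝ) 1, |f.eval x - p.eval x| ≤ B (√(1 - x ^ 2)) := by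
  obtain ⟨p, hp, hpe⟩ := Tr_even_poly hT
  refine ⟨p, hp, fun x hx => ?_⟩
  have hc := cos_arccos hx.1 hx.2
  set t := arccos x with ht
  have hs : |sin t| = √(1 - x ^ 2) := by
    rw [ht, sin_arccos, abs_of_nonneg (sqrt_nonneg _)]
  have h1 := h t
  have h2 := h (-t)
  rw [cos_neg, sin_neg, abs_neg] at h2
  have h3 := hpe t
  rw [hc, hs] at h1 h2
  rw [hc] at h3
  rw [← h3]
  rw [abs_le] at *
  constructor <;> linarith [h1.1, h1.2, h2.1, h2.2]

theorem poly_main (m : ℕ) : ∃ C : ℝ, ∀ f : Polynomial ℝ,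
    (∀ x ∈ Set.Icc (-1 : ℝ) 1, |(Polynomial.derivative^[m + 1] f).eval x| ≤ 1) → ∀ n : ℕ, m ≤ n →
    ∃ p : Polynomial ℝ, p.natDegree ≤ n ∧ ∀ x ∈ Set.Icc (-1 : ℝ) 1, |f.eval x - p.eval x| ≤
      favardK (m + 1) * (√(1 - x ^ 2) / (n + 1)) ^ (m + 1) + C * √(1 - x ^ 2) ^ m / (n + 1) ^ (m + 2) := by
  obtain ⟨C1, hC1, n0, h1⟩ := poly_large m
  obtain ⟨C2, hC2, h2⟩ := poly_small m
  have hK := favardK_nonneg m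
  refine ⟨C1 + C2 * (n0 + 1) ^ (m + 2), fun f hf n hn => ?_⟩
  by_cases hnn : n0 ≤ n
  · obtain ⟨T, hT, hb⟩ := h1 f hf n hnn
    refine to_poly (B := fun s => favardK (m + 1) * (s / (n + 1)) ^ (m + 1) +
      (C1 + C2 * (n0 + 1) ^ (m + 2)) * s ^ m / (n + 1) ^ (m + 2)) hT fun t => (hb t).trans ?_
    gcongr
    have : 0 ≤ C2 * ((n0 : ℝ) + 1) ^ (m + 2) := by positivity
    linarith
  · obtain ⟨T, hT, hb⟩ := h2 f hf
    refine to_poly (B := fun s => favardK (m + 1) * (s / (n + 1)) ^ (m + 1) +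
      (C1 + C2 * (n0 + 1) ^ (m + 2)) * s ^ m / (n + 1) ^ (m + 2)) (Tr_mono hn hT) fun t => (hb t).trans ?_
    have h3 : ((n : ℝ) + 1) ^ (m + 2) ≤ (n0 + 1) ^ (m + 2) := by
      gcongr; omega
    have h4 : C2 * |sin t| ^ m ≤ C2 * ((n0 : ℝ) + 1) ^ (m + 2) * |sin t| ^ m / (n + 1) ^ (m + 2) := by
      rw [le_div_iff₀ (by positivity)]
      calc _ ≤ C2 * |sin t| ^ m * (n0 + 1) ^ (m + 2) := mul_le_mul_of_nonneg_left h3 (by positivity)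
        _ = _ := by ring
    have h5 : 0 ≤ favardK (m + 1) * (|sin t| / (n + 1)) ^ (m + 1) := by positivity
    have h6 : 0 ≤ C1 * |sin t| ^ m / ((n : ℝ) + 1) ^ (m + 2) := by positivity
    rw [add_mul, add_div]
    linarith

end Trigub

namespace Trigub

theorem antideriv_poly (p : Polynomial ℝ) (c : ℝ) : ∃ q : Polynomial ℝ, Polynomial.derivative q = p ∧ q.eval 0 = c := by
  have h : ∃ q : Polynomial ℝ, Polynomial.derivative q = p := by
    induction p using Polynomial.induction_on' with
    | add p q hp hq =>
      obtain ⟨a, ha⟩ := hp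
      obtain ⟨b, hb⟩ := hq
      exact ⟨a + b, by rw [Polynomial.derivative_add, ha, hb]⟩
    | monomial k a =>
      refine ⟨Polynomial.monomial (k + 1) (a / (k + 1)), ?_⟩
      rw [Polynomial.derivative_monomial]
      congr 1
      push_cast
      have : (k : ℝ) + 1 ≠ 0 := by positivity
      field_simp
  obtain ⟨q, hq⟩ := h
  exact ⟨q + Polynomial.C (c - q.eval 0), by simp [hq], by simp⟩

theorem seg_mvt {g g' : ℝ → ℝ} {ε : ℝ} (hg : ∀ x ∈ Set.Icc (-1 : ℝ) 1, HasDerivWithinAt g (g' x) (Set.Icc (-1) 1) x)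
    (h0 : g 0 = 0) (hb : ∀ x ∈ Set.Icc (-1 : ℝ) 1, |g' x| ≤ ε) : ∀ x ∈ Set.Icc (-1 : ℝ) 1, |g x| ≤ ε := by
  intro x hx
  have := Convex.norm_image_sub_le_of_norm_hasDerivWithin_le hg hb (convex_Icc _ _)
    (x := 0) (y := x) (by constructor <;> norm_num) hx
  simp only [h0, sub_zero, Real.norm_eq_abs] at this
  have hε : 0 ≤ ε := (abs_nonneg _).trans (hb x hx)
  refine this.trans (mul_le_of_le_one_right hε (abs_le.2 hx))

theorem approx_base {f : ℝ → ℝ} (hf : LipschitzOnWith 1 f (Set.Icc (-1 : ℝ) 1)) {ε : ℝ} (hε : 0 < ε) :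
    ∃ P : Polynomial ℝ, (∀ x ∈ Set.Icc (-1 : ℝ) 1, |(Polynomial.derivative P).eval x| ≤ 1) ∧
      ∀ x ∈ Set.Icc (-1 : ℝ) 1, |f x - P.eval x| ≤ ε := by
  obtain ⟨F, hF, hFe⟩ := hf.extend_real
  have hFc := hF.continuous
  have hFl : ∀ x y, |F x - F y| ≤ |x - y| := fun x y => by
    have := hF.dist_le_mul x y
    simpa [Real.dist_eq] using this
  set h := ε / 2 with hh
  have hh0 : 0 < h := by positivity
  set G : ℝ → ℝ := fun x => ∫ u in (0:ℝ)..x, F u with hG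
  have hGd : ∀ x, HasDerivAt G (F x) x := fun x =>
    intervalIntegral.integral_hasDerivAt_right (hFc.intervalIntegrable _ _)
      (hFc.stronglyMeasurableAtFilter _ _) hFc.continuousAt
  set A : ℝ → ℝ := fun x => (G (x + h) - G x) / h with hA
  set A' : ℝ → ℝ := fun x => (F (x + h) - F x) / h with hA'
  have hAd : ∀ x, HasDerivAt A (A' x) x := fun x =>
    (((hGd (x + h)).comp_add_const x h).sub (hGd x)).div_const h
  have hA'b : ∀ x, |A' x| ≤ 1 := fun x => by
    simp only [hA']
    rw [abs_div, abs_of_pos hh0, div_le_one hh0]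
    have := hFl (x + h) x
    rwa [add_sub_cancel_left, abs_of_pos hh0] at this
  have hAF : ∀ x, |F x - A x| ≤ h := fun x => by
    obtain ⟨ξ, hξ, he⟩ := exists_hasDerivAt_eq_slope G F (show x < x + h by linarith)
      (fun y _ => (hGd y).continuousAt.continuousWithinAt) (fun y _ => hGd y)
    rw [add_sub_cancel_left] at he
    simp only [hA]
    rw [← he]
    refine (hFl x ξ).trans ?_
    rw [abs_le]; constructor <;> linarith [hξ.1, hξ.2]
  set δ := ε / 4 with hδ
  have hδ0 : 0 < δ := by positivity
  have hA'c : Continuous A' := by simp only [hA']; fun_prop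
  obtain ⟨p, hp⟩ := exists_polynomial_near_of_continuousOn (-1) 1 A' hA'c.continuousOn δ hδ0
  obtain ⟨P, hP, hP0⟩ := antideriv_poly (Polynomial.C (1 / (1 + δ)) * p) (A 0)
  have hpe : ∀ x, (Polynomial.derivative P).eval x = p.eval x / (1 + δ) := fun x => by
    rw [hP]; simp; ring
  refine ⟨P, fun x hx => ?_, fun x hx => ?_⟩
  · rw [hpe, abs_div, abs_of_pos (by linarith : 0 < 1 + δ), div_le_one (by linarith)]
    have h1 := hp x hx
    have h2 := hA'b x
    rw [abs_lt] at h1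
    rw [abs_le] at *
    constructor <;> linarith [h1.1, h1.2, h2.1, h2.2]
  · have key := seg_mvt (g := fun x => A x - P.eval x) (g' := fun x => A' x - (Polynomial.derivative P).eval x)
      (ε := 2 * δ) (fun x _ => ((hAd x).sub (P.hasDerivAt x)).hasDerivWithinAt) (by simp [hP0]) (fun x hx => by
        rw [hpe]
        have h1 := hp x hx
        have h2 := hA'b x
        have e : A' x - p.eval x / (1 + δ) = ((A' x - p.eval x) + δ * A' x) / (1 + δ) := by
          field_simp; ring
        rw [e, abs_div, abs_of_pos (by linarith : 0 < 1 + δ)]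
        rw [abs_sub_comm] at h1
        have h3 : |(A' x - p.eval x) + δ * A' x| ≤ 2 * δ := by
          refine (abs_add_le _ _).trans ?_
          rw [abs_mul, abs_of_pos hδ0]
          nlinarith
        refine (div_le_self (abs_nonneg _) (by linarith)).trans h3) x hx
    have h1 := hAF x
    rw [← hFe hx] at h1
    have : f x - P.eval x = (f x - A x) + (A x - P.eval x) := by ring
    rw [this]
    refine (abs_add_le _ _).trans ?_
    linarith

theorem approx_poly (m : ℕ) : ∀ f : ℝ → ℝ, MemWSegment (m + 1) f → ∀ ε : ℝ, 0 < ε →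
    ∃ P : Polynomial ℝ, (∀ x ∈ Set.Icc (-1 : ℝ) 1, |(Polynomial.derivative^[m + 1] P).eval x| ≤ 1) ∧
      ∀ x ∈ Set.Icc (-1 : ℝ) 1, |f x - P.eval x| ≤ ε := by
  induction m with
  | zero =>
    intro f hf ε hε
    have := hf.2
    simp only [zero_add, Nat.sub_self, iteratedDerivWithin_zero] at this
    simpa using approx_base this hε
  | succ m ih =>
    intro f hf ε hε
    have hs : ∀ i, iteratedDerivWithin i (derivWithin f (Set.Icc (-1 : ℝ) 1)) (Set.Icc (-1 : ℝ) 1) =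
        iteratedDerivWithin (i + 1) f (Set.Icc (-1 : ℝ) 1) := fun i => by
      funext x
      rw [iteratedDerivWithin_eq_iterate, iteratedDerivWithin_eq_iterate, Function.iterate_succ_apply]
    obtain ⟨P, hP1, hP2⟩ := ih (derivWithin f (Set.Icc (-1 : ℝ) 1)) ⟨fun i hi => by
      rw [hs]; exact hf.1 (i + 1) (by omega), by
      rw [hs]; exact hf.2⟩ ε hε
    obtain ⟨Q, hQ, hQ0⟩ := antideriv_poly P (f 0)
    refine ⟨Q, fun x hx => ?_, fun x hx => ?_⟩
    · rw [Function.iterate_succ_apply, hQ]; exact hP1 x hx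
    · have hd : DifferentiableOn ℝ f (Set.Icc (-1 : ℝ) 1) := by
        have := hf.1 0 (by omega)
        simpa only [iteratedDerivWithin_zero] using this
      exact seg_mvt (g := fun x => f x - Q.eval x) (g' := fun x => derivWithin f (Set.Icc (-1 : ℝ) 1) x - P.eval x)
        (fun x hx => ((hd x hx).hasDerivWithinAt).sub (by
          have := (Q.hasDerivAt x).hasDerivWithinAt (s := Set.Icc (-1 : ℝ) 1)
          rwa [hQ] at this)) (by simp [hQ0]) hP2 x hx

theorem poly_compact (n : ℕ) (f B : ℝ → ℝ)
    (h : ∀ k : ℕ, ∃ p : Polynomial ℝ, p.natDegree ≤ n ∧ ∀ x ∈ Set.Icc (-1 : ℝ) 1,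
      |f x - p.eval x| ≤ B x + 1 / ((k : ℝ) + 1)) :
    ∃ p : Polynomial ℝ, p.natDegree ≤ n ∧ ∀ x ∈ Set.Icc (-1 : ℝ) 1, |f x - p.eval x| ≤ B x := by
  choose p hp hb using h
  set v : Fin (n + 1) → ℝ := fun i => (i : ℕ) / ((n : ℝ) + 1) with hv
  have hvi : Function.Injective v := fun i j hij => by
    simp only [hv] at hij
    have : (n : ℝ) + 1 ≠ 0 := by positivity
    rw [div_left_inj' this] at hij
    exact Fin.ext (by exact_mod_cast hij)
  have hvI : ∀ i, v i ∈ Set.Icc (-1 : ℝ) 1 := fun i => by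
    have h1 : (0 : ℝ) ≤ v i := by positivity
    refine ⟨by linarith, ?_⟩
    simp only [hv]
    rw [div_le_one (by positivity)]
    have : ((i : ℕ) : ℝ) ≤ n := by exact_mod_cast Nat.lt_succ_iff.1 i.2
    linarith
  set r : ℕ → Fin (n + 1) → ℝ := fun k i => (p k).eval (v i) with hr
  set R : ℝ := ∑ i, (|f (v i)| + |B (v i)| + 1) with hR
  have hrb : ∀ k, r k ∈ Metric.closedBall (0 : Fin (n + 1) → ℝ) R := fun k => by
    rw [mem_closedBall_zero_iff, pi_norm_le_iff_of_nonneg (Finset.sum_nonneg fun i _ => by positivity)]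
    intro i
    refine le_trans ?_ (Finset.single_le_sum (f := fun i => |f (v i)| + |B (v i)| + 1)
      (fun i _ => by positivity) (Finset.mem_univ i))
    have h1 := hb k (v i) (hvI i)
    have h2 : 1 / ((k : ℝ) + 1) ≤ 1 := by
      rw [div_le_one (by positivity)]; linarith [(Nat.cast_nonneg k : (0:ℝ) ≤ k)]
    have h3 := le_abs_self (B (v i))
    have e : r k i = f (v i) - (f (v i) - (p k).eval (v i)) := by simp [hr]
    rw [Real.norm_eq_abs, e]
    refine (abs_sub _ _).trans ?_
    linarith
  obtain ⟨ρ, -, φ, hφ, hlim⟩ := tendsto_subseq_of_bounded Metric.isBounded_closedBall hrb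
  have hinj : Set.InjOn v (Finset.univ : Finset (Fin (n + 1))) := hvi.injOn
  refine ⟨Lagrange.interpolate Finset.univ v ρ, ?_, fun x hx => ?_⟩
  · have := Lagrange.degree_interpolate_lt ρ hinj
    rw [Finset.card_univ, Fintype.card_fin] at this
    by_cases h0 : Lagrange.interpolate Finset.univ v ρ = 0
    · simp [h0]
    · exact Nat.lt_succ_iff.1 ((Polynomial.natDegree_lt_iff_degree_lt h0).2 this)
  · have hpe : ∀ k, (p k).eval x = ∑ i, r k i * (Lagrange.basis Finset.univ v i).eval x := fun k => by
      have hd : (p k).degree < (Finset.univ : Finset (Fin (n + 1))).card := by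
        rw [Finset.card_univ, Fintype.card_fin]
        exact lt_of_le_of_lt Polynomial.degree_le_natDegree (by exact_mod_cast Nat.lt_succ_iff.2 (hp k))
      conv_lhs => rw [Lagrange.eq_interpolate hinj hd, Lagrange.interpolate_apply, Polynomial.eval_finsetSum]
      simp [hr]
    have hρe : (Lagrange.interpolate Finset.univ v ρ).eval x = ∑ i, ρ i * (Lagrange.basis Finset.univ v i).eval x := by
      rw [Lagrange.interpolate_apply, Polynomial.eval_finsetSum]; simp
    have ht : Filter.Tendsto (fun k => (p (φ k)).eval x) Filter.atTop
        (nhds ((Lagrange.interpolate Finset.univ v ρ).eval x)) := by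
      rw [hρe]
      simp only [hpe]
      refine tendsto_finsetSum _ fun i _ => Filter.Tendsto.mul_const _ ?_
      exact (tendsto_pi_nhds.1 hlim) i
    have ht2 : Filter.Tendsto (fun k => B x + 1 / ((φ k : ℝ) + 1)) Filter.atTop (nhds (B x + 0)) :=
      (tendsto_one_div_add_atTop_nhds_zero_nat.comp hφ.tendsto_atTop).const_add _
    rw [add_zero] at ht2
    exact le_of_tendsto_of_tendsto' (ht.const_sub (f x)).abs ht2 fun k => hb (φ k) x hx

end Trigub

theorem trigub_asymptotically_sharp_pointwise (r : ℕ) (hr : 1 ≤ r) :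
    ∃ c : ℝ, ∀ f : ℝ → ℝ, MemWSegment r f →
      ∀ n : ℕ, r - 1 ≤ n →
        ∃ p : Polynomial ℝ, p.natDegree ≤ n ∧
          ∀ x ∈ Set.Icc (-1 : ℝ) 1,
            |f x - p.eval x| ≤
              favardK r * (Real.sqrt (1 - x ^ 2) / (n + 1)) ^ r +
                c * (Real.sqrt (1 - x ^ 2)) ^ (r - 1) / (n + 1) ^ (r + 1) := by
  obtain ⟨m, rfl⟩ : ∃ m, r = m + 1 := ⟨r - 1, by omega⟩
  obtain ⟨C, hC⟩ := Trigub.poly_main m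
  refine ⟨C, fun f hf n hn => ?_⟩
  refine Trigub.poly_compact n f _ fun k => ?_
  obtain ⟨P, hP1, hP2⟩ := Trigub.approx_poly m f hf (1 / ((k : ℝ) + 1)) (by positivity)
  obtain ⟨p, hp, hb⟩ := hC P hP1 n (by simpa using hn)
  refine ⟨p, hp, fun x hx => ?_⟩
  have h1 := hP2 x hx
  have h2 := hb x hx
  have e : f x - p.eval x = (f x - P.eval x) + (P.eval x - p.eval x) := by ring
  rw [e]
  refine (abs_add_le _ _).trans ?_
  simp only [Nat.add_sub_cancel]
  linarith
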